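/- arXiv:2307.04839 — 4 statements merged into one kernel-verified Lean document; each statement's English description precedes it below -/
import Mathlib

section
/- For all positive integers n, r and every T ⊆ [n], the polynomial A^T_{n,r}(x) = Σ_{u ∈ S_n[ℤ_r] : Des(u) ⊆ T} x^{des(u)} is real-rooted and is interlaced by A^T_n(x). -/
open Polynomial

open scoped Classical

noncomputable section

/-- The descent set of a permutation `w` of `Fin n`, recorded as a subset of
`{1, ..., n-1}` (1-based positions, as in the paper: `i ∈ Des(w)` iff `w(i) > w(i+1)`). -/
def descSet {n : ℕ} (w : Equiv.Perm (Fin n)) : Finset ℕ :=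
  (Finset.univ.filter (fun i : Fin (n - 1) =>
      w ⟨i.val + 1, by have := i.isLt; omega⟩ < w ⟨i.val, by have := i.isLt; omega⟩)).image
    (fun i => i.val + 1)

/-- `A^T_n(x) = Σ_{w ∈ S_n, Des(w) ⊆ T} x^{des(w)}` (note `Des(w) ⊆ {1,...,n-1}`
automatically, so this also realizes the convention `A^T_n := A^{T ∩ [n-1]}_n`). -/
def Apoly (n : ℕ) (T : Finset ℕ) : Polynomial ℝ :=
  ∑ w ∈ Finset.univ.filter (fun w : Equiv.Perm (Fin n) => descSet w ⊆ T),
    X ^ (descSet w).card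

/-- `p^T_{n,k}(x) = Σ x^{des(w)}` over permutations `w ∈ S_{n+1}` with `w(1) = k+1`
(0-based: `w 0 = k`) and `Des(w) ⊆ T`. -/
def ppoly (n k : ℕ) (T : Finset ℕ) : Polynomial ℝ :=
  ∑ w ∈ Finset.univ.filter (fun w : Equiv.Perm (Fin (n + 1)) =>
      (w 0 : ℕ) = k ∧ descSet w ⊆ T),
    X ^ (descSet w).card

/-- A real polynomial has only real roots (or is identically zero). -/
def RealRooted (p : Polynomial ℝ) : Prop :=
  p = 0 ∨ ∀ z : ℂ, Polynomial.aeval z p = 0 → z.im = 0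

/-- The list of real roots of `p`, with multiplicity, in decreasing order. -/
def rootsDesc (p : Polynomial ℝ) : List ℝ :=
  (p.roots.sort (· ≤ ·)).reverse

/-- `Interlaces p q` means `p ⪯ q`: both are real-rooted and, listing the roots of `p`
as `α_1 ≥ α_2 ≥ ⋯` and those of `q` as `β_1 ≥ β_2 ≥ ⋯`, one has
`⋯ ≤ α_2 ≤ β_2 ≤ α_1 ≤ β_1`; by convention the zero polynomial interlaces and is
interlaced by every real-rooted polynomial. -/
def Interlaces (p q : Polynomial ℝ) : Prop :=
  (p = 0 ∧ RealRooted q) ∨ (q = 0 ∧ RealRooted p) ∨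
  (RealRooted p ∧ RealRooted q ∧
    Multiset.card q.roots ≤ Multiset.card p.roots + 1 ∧
    Multiset.card p.roots ≤ Multiset.card q.roots ∧
    (∀ (i : ℕ) (hp : i < (rootsDesc p).length) (hq : i < (rootsDesc q).length),
      (rootsDesc p).get ⟨i, hp⟩ ≤ (rootsDesc q).get ⟨i, hq⟩) ∧
    (∀ (i : ℕ) (hq : i + 1 < (rootsDesc q).length) (hp : i < (rootsDesc p).length),
      (rootsDesc q).get ⟨i + 1, hq⟩ ≤ (rootsDesc p).get ⟨i, hp⟩))

/-- The descent set of an `r`-colored permutation `(w, z)` of `[n]`, as a subset of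
`{1,…,n}` (1-based): setting `w(n+1) = n+1` and `z_{n+1} = 0`, position `i ∈ [n]` is a
descent iff `z_i > z_{i+1}`, or `z_i = z_{i+1}` and `w(i) > w(i+1)`. -/
def descSetC {n r : ℕ} (w : Equiv.Perm (Fin n)) (z : Fin n → Fin r) : Finset ℕ :=
  (Finset.univ.filter (fun i : Fin n =>
      (∀ h : i.val + 1 < n,
        z ⟨i.val + 1, h⟩ < z i ∨ (z i = z ⟨i.val + 1, h⟩ ∧ w ⟨i.val + 1, h⟩ < w i)) ∧
      (i.val + 1 = n → 0 < (z i : ℕ)))).image (fun i => i.val + 1)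

/-- `A^T_{n,r}(x) = Σ_{u ∈ S_n[ℤ_r], Des(u) ⊆ T} x^{des(u)}`. -/
def Acolored (n r : ℕ) (T : Finset ℕ) : Polynomial ℝ :=
  ∑ u ∈ Finset.univ.filter
      (fun u : Equiv.Perm (Fin n) × (Fin n → Fin r) => descSetC u.1 u.2 ⊆ T),
    X ^ (descSetC u.1 u.2).card


/-- Append the value `k` at the end of the permutation `w` (standardizing). -/
def appendPerm {n : ℕ} (k : Fin (n + 1)) (w : Equiv.Perm (Fin n)) : Equiv.Perm (Fin (n + 1)) :=
  (finSuccEquivLast.trans (Equiv.optionCongr w)).trans (finSuccEquiv' k).symm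

lemma appendPerm_castSucc {n : ℕ} (k : Fin (n + 1)) (w : Equiv.Perm (Fin n)) (i : Fin n) :
    appendPerm k w i.castSucc = k.succAbove (w i) := by
  simp [appendPerm]

lemma appendPerm_last {n : ℕ} (k : Fin (n + 1)) (w : Equiv.Perm (Fin n)) :
    appendPerm k w (Fin.last n) = k := by
  simp [appendPerm]

lemma appendPerm_bij (n : ℕ) : Function.Bijective
    (fun p : Fin (n + 1) × Equiv.Perm (Fin n) => appendPerm p.1 p.2) := by
  rw [Fintype.bijective_iff_injective_and_card]
  constructor
  · rintro ⟨k, w⟩ ⟨k', w'⟩ h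
    simp only at h
    have h1 : k = k' := by
      have := congrArg (fun e => e (Fin.last n)) h
      simpa only [appendPerm_last] using this
    subst h1
    have h2 : w = w' := by
      ext i
      have := congrArg (fun e => e i.castSucc) h
      simp only [appendPerm_castSucc] at this
      rw [Fin.succAbove_right_injective this]
    rw [h2]
  · simp [Fintype.card_perm, Nat.factorial_succ]

lemma appendPerm_mul {n : ℕ} (k : Fin (n + 1)) (t w : Equiv.Perm (Fin n)) :
    appendPerm k t * appendPerm (Fin.last n) w = appendPerm k (t * w) := by
  ext i
  refine Fin.lastCases ?_ (fun i => ?_) i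
  · simp [Equiv.Perm.mul_apply, appendPerm_last]
  · simp [Equiv.Perm.mul_apply, appendPerm_castSucc]

lemma mem_descSet {n : ℕ} (w : Equiv.Perm (Fin n)) (i : ℕ) :
    i ∈ descSet w ↔ ∃ j, ∃ h : j + 1 < n, i = j + 1 ∧ w ⟨j + 1, h⟩ < w ⟨j, by omega⟩ := by
  unfold descSet
  simp only [Finset.mem_image, Finset.mem_filter, Finset.mem_univ, true_and]
  constructor
  · rintro ⟨j, hj, rfl⟩
    exact ⟨j.val, by have := j.isLt; omega, rfl, hj⟩
  · rintro ⟨j, h, rfl, hj⟩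
    exact ⟨⟨j, by omega⟩, hj, rfl⟩

lemma mem_descSetC {n r : ℕ} (w : Equiv.Perm (Fin n)) (z : Fin n → Fin r) (i : ℕ) :
    i ∈ descSetC w z ↔ ∃ j, ∃ h : j < n, i = j + 1 ∧
      (∀ h' : j + 1 < n, z ⟨j + 1, h'⟩ < z ⟨j, h⟩ ∨
        (z ⟨j, h⟩ = z ⟨j + 1, h'⟩ ∧ w ⟨j + 1, h'⟩ < w ⟨j, h⟩)) ∧
      (j + 1 = n → 0 < (z ⟨j, h⟩ : ℕ)) := by
  unfold descSetC
  simp only [Finset.mem_image, Finset.mem_filter, Finset.mem_univ, true_and]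
  constructor
  · rintro ⟨j, hj, rfl⟩
    exact ⟨j.val, j.isLt, rfl, hj⟩
  · rintro ⟨j, h, rfl, hj⟩
    exact ⟨⟨j, by omega⟩, hj, rfl⟩

lemma descSet_append {n : ℕ} (k : Fin (n + 2)) (v : Equiv.Perm (Fin (n + 1))) :
    descSet (appendPerm k v) =
      if k ≤ (v (Fin.last n)).castSucc then insert (n + 1) (descSet v) else descSet v := by
  have key : ∀ i, i ∈ descSet (appendPerm k v) ↔
      (i ∈ descSet v ∨ (i = n + 1 ∧ k ≤ (v (Fin.last n)).castSucc)) := by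
    intro i
    rw [mem_descSet, mem_descSet]
    constructor
    · rintro ⟨j, h, rfl, hj⟩
      rcases Nat.lt_or_ge (j + 1) (n + 1) with h1 | h1
      · left
        refine ⟨j, h1, rfl, ?_⟩
        have e1 := appendPerm_castSucc k v ⟨j + 1, h1⟩
        have e2 := appendPerm_castSucc k v ⟨j, by omega⟩
        simp only [Fin.castSucc_mk] at e1 e2
        rw [e1, e2] at hj
        exact Fin.succAbove_lt_succAbove_iff.mp hj
      · right
        obtain rfl : j = n := by omega
        refine ⟨rfl, ?_⟩
        have e1 := appendPerm_last k v
        have e2 := appendPerm_castSucc k v (Fin.last j)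
        have e3 : (⟨j + 1, h⟩ : Fin (j + 2)) = Fin.last (j + 1) := rfl
        have e4 : (⟨j, by omega⟩ : Fin (j + 2)) = (Fin.last j).castSucc := rfl
        rw [e3, e4, e1, e2] at hj
        exact (Fin.lt_succAbove_iff_le_castSucc _ _).mp hj
    · rintro (⟨j, h, rfl, hj⟩ | ⟨rfl, hk⟩)
      · refine ⟨j, by omega, rfl, ?_⟩
        have e1 := appendPerm_castSucc k v ⟨j + 1, h⟩
        have e2 := appendPerm_castSucc k v ⟨j, by omega⟩
        simp only [Fin.castSucc_mk] at e1 e2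
        rw [e1, e2]
        exact Fin.succAbove_lt_succAbove_iff.mpr hj
      · refine ⟨n, by omega, rfl, ?_⟩
        have e1 := appendPerm_last k v
        have e2 := appendPerm_castSucc k v (Fin.last n)
        have e3 : (⟨n + 1, by omega⟩ : Fin (n + 2)) = Fin.last (n + 1) := rfl
        have e4 : (⟨n, by omega⟩ : Fin (n + 2)) = (Fin.last n).castSucc := rfl
        rw [e3, e4, e1, e2]
        exact (Fin.lt_succAbove_iff_le_castSucc _ _).mpr hk
  ext i
  rw [key]
  split_ifs with h
  · simp [h, or_comm]
  · simp [h]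

lemma last_notMem_descSet {n : ℕ} (v : Equiv.Perm (Fin (n + 1))) : n + 1 ∉ descSet v := by
  rw [mem_descSet]
  rintro ⟨j, h, h1, -⟩
  omega

/-- weight of a descent set -/
def wt (T D : Finset ℕ) : Polynomial ℝ := if D ⊆ T then X ^ D.card else 0

/-- generating polynomial of permutations of `Fin (n+1)` with last value `k` -/
def Q (T : Finset ℕ) (n : ℕ) (k : Fin (n + 1)) : Polynomial ℝ :=
  ∑ w : Equiv.Perm (Fin n), wt T (descSet (appendPerm k w))

lemma Q_succ (T : Finset ℕ) (n : ℕ) (k : Fin (n + 2)) :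
    Q T (n + 1) k = ∑ j : Fin (n + 1),
      (if k ≤ j.castSucc then (if n + 1 ∈ T then X else 0) else 1) * Q T n j := by
  unfold Q
  simp only [Finset.mul_sum]
  rw [← (appendPerm_bij n).sum_comp
    (fun v : Equiv.Perm (Fin (n + 1)) => wt T (descSet (appendPerm k v))),
    Fintype.sum_prod_type]
  refine Finset.sum_congr rfl fun j _ => Finset.sum_congr rfl fun w _ => ?_
  simp only
  rw [descSet_append k, appendPerm_last]
  split_ifs with h h1
  · unfold wt
    rw [Finset.card_insert_of_notMem (last_notMem_descSet _)]
    simp only [Finset.insert_subset_iff, h1, true_and]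
    split_ifs
    · ring
    · simp
  · unfold wt
    rw [if_neg (by simp [Finset.insert_subset_iff, h1])]
    simp
  · simp

lemma Apoly_eq (T : Finset ℕ) (n : ℕ) : Apoly n T = Q T n (Fin.last n) := by
  unfold Apoly Q wt
  rw [Finset.sum_filter]
  refine Finset.sum_congr rfl fun w _ => ?_
  have : descSet (appendPerm (Fin.last n) w) = descSet w := by
    cases n with
    | zero => ext i; simp [mem_descSet]
    | succ n =>
      rw [descSet_append, if_neg]
      rw [not_le]
      exact Fin.castSucc_lt_last _
  rw [this]

/-- sort key of colored letters, `Fin.last n` being the sentinel -/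
def ckey {n r : ℕ} (f : Fin n → Fin r) (a : Fin (n + 1)) : ℕ ×ₗ ℕ :=
  toLex (if h : a.val < n then (f ⟨a.val, h⟩ : ℕ) else 0, a.val)

lemma ckey_inj {n r : ℕ} (f : Fin n → Fin r) : Function.Injective (ckey f) := by
  intro a b h
  unfold ckey at h
  have := congrArg (fun p => (ofLex p).2) h
  exact Fin.ext this

lemma exists_std {m : ℕ} {β : Type} [LinearOrder β] (g : Fin m → β) (hg : Function.Injective g) :
    ∃ s : Equiv.Perm (Fin m), ∀ a b, s a < s b ↔ g a < g b := by
  have hc : Fintype.card (Set.range g) = m := by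
    rw [Set.card_range_of_injective hg]; simp
  let e := monoEquivOfFin (Set.range g) hc
  refine ⟨(Equiv.ofInjective g hg).trans e.symm.toEquiv, fun a b => ?_⟩
  simp only [Equiv.trans_apply, Equiv.ofInjective_apply]
  exact (e.symm.lt_iff_lt).trans Iff.rfl

lemma colored_sum {n r : ℕ} (T : Finset ℕ) (f : Fin n → Fin r) :
    ∃ k : Fin (n + 1), ((∀ a, (f a : ℕ) = 0) → k = Fin.last n) ∧
      ∑ w : Equiv.Perm (Fin n), wt T (descSetC w (f ∘ w)) = Q T n k := by
  obtain ⟨s, hs⟩ := exists_std (ckey f) (ckey_inj f)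
  obtain ⟨⟨k, t⟩, ht⟩ := (appendPerm_bij n).2 s
  simp only at ht
  refine ⟨k, ?_, ?_⟩
  · intro h0
    have hk : s (Fin.last n) = k := by rw [← ht, appendPerm_last]
    obtain ⟨a, ha⟩ := s.surjective (Fin.last n)
    by_contra hne
    have : s (Fin.last n) < s a := by
      rw [ha, hk]; exact Fin.lt_last_iff_ne_last.mpr hne
    rw [hs] at this
    unfold ckey at this
    rw [Prod.Lex.toLex_lt_toLex] at this
    simp only [h0] at this
    have := a.isLt
    simp at *
    omega
  · unfold Q
    rw [← Equiv.sum_comp (Equiv.mulLeft t)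
      (fun w : Equiv.Perm (Fin n) => wt T (descSet (appendPerm k w)))]
    refine Finset.sum_congr rfl fun w _ => ?_
    rw [Equiv.coe_mulLeft, ← appendPerm_mul, ht]
    congr 1
    ext i
    rw [mem_descSet, mem_descSetC]
    have e : ∀ j, ∀ h : j + 1 < n + 1, (((s * appendPerm (Fin.last n) w) ⟨j + 1, h⟩ <
        (s * appendPerm (Fin.last n) w) ⟨j, by omega⟩) ↔
          (∀ h' : j + 1 < n, f (w ⟨j + 1, h'⟩) < f (w ⟨j, by omega⟩) ∨
        (f (w ⟨j, by omega⟩) = f (w ⟨j + 1, h'⟩) ∧ w ⟨j + 1, h'⟩ < w ⟨j, by omega⟩)) ∧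
      (j + 1 = n → 0 < (f (w ⟨j, by omega⟩) : ℕ))) := by
      intro j h
      rw [Equiv.Perm.mul_apply, Equiv.Perm.mul_apply, hs]
      have e2 := appendPerm_castSucc (Fin.last n) w ⟨j, by omega⟩
      simp only [Fin.castSucc_mk, Fin.succAbove_last] at e2
      rw [e2]
      rcases Nat.lt_or_ge (j + 1) n with h1 | h1
      · have e1 := appendPerm_castSucc (Fin.last n) w ⟨j + 1, h1⟩
        simp only [Fin.castSucc_mk, Fin.succAbove_last] at e1
        rw [e1]
        unfold ckey
        rw [Prod.Lex.toLex_lt_toLex]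
        have hne : j + 1 ≠ n := by omega
        simp only [h1, hne, forall_true_left, IsEmpty.forall_iff, and_true]
        generalize w ⟨j + 1, h1⟩ = a
        generalize w ⟨j, _⟩ = b
        have ha := a.isLt
        have hb := b.isLt
        simp only [Fin.val_castSucc, ha, hb, dif_pos, Fin.eta, Fin.lt_def, Fin.ext_iff]
        omega
      · obtain rfl : n = j + 1 := by omega
        have e1 := appendPerm_last (Fin.last (j + 1)) w
        have e3 : (⟨j + 1, h⟩ : Fin (j + 2)) = Fin.last (j + 1) := rfl
        rw [e3, e1]
        unfold ckey
        rw [Prod.Lex.toLex_lt_toLex]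
        have := (w ⟨j, by omega⟩).isLt
        have hle : ((w ⟨j, by omega⟩ : Fin (j + 1)) : ℕ) ≤ j := by omega
        simp [hle]
    constructor
    · rintro ⟨j, h, h1, h2⟩
      exact ⟨j, by omega, h1, (e j (by omega)).mpr h2⟩
    · rintro ⟨j, h, h1, h2⟩
      exact ⟨j, by omega, h1, (e j (by omega)).mp h2⟩

lemma Acolored_eq (n r : ℕ) (T : Finset ℕ) : ∃ κ : (Fin n → Fin r) → Fin (n + 1),
    (∀ f, (∀ a, (f a : ℕ) = 0) → κ f = Fin.last n) ∧
    Acolored n r T = ∑ f, Q T n (κ f) := by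
  choose κ h1 h2 using fun f : Fin n → Fin r => colored_sum T f
  refine ⟨κ, h1, ?_⟩
  simp only [← h2]
  unfold Acolored
  rw [Finset.sum_filter, Fintype.sum_prod_type, Finset.sum_comm]
  rw [Finset.sum_comm, Finset.sum_comm (s := (Finset.univ : Finset (Fin n → Fin r)))]
  refine Finset.sum_congr rfl fun w _ => ?_
  rw [← (Equiv.arrowCongr w.symm (Equiv.refl (Fin r))).sum_comp]
  rfl

/-- cone relation at the point `z` -/
def CW (a b : ℂ) : ℝ := b.im * a.re - b.re * a.im

/-- `b / a` has argument in `[0, arg z]` -/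
def CK (z a b : ℂ) : Prop := 0 ≤ CW a b ∧ 0 ≤ CW b (z * a)

lemma CK_add_left {z a b c : ℂ} (h : CK z a c) (h' : CK z b c) : CK z (a + b) c := by
  obtain ⟨h1, h2⟩ := h
  obtain ⟨h3, h4⟩ := h'
  constructor <;>
  · simp only [CW, Complex.add_re, Complex.add_im, Complex.mul_re, Complex.mul_im] at *
    nlinarith

lemma CK_add_right {z a b c : ℂ} (h : CK z a b) (h' : CK z a c) : CK z a (b + c) := by
  obtain ⟨h1, h2⟩ := h
  obtain ⟨h3, h4⟩ := h'
  constructor <;>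
  · simp only [CW, Complex.add_re, Complex.add_im, Complex.mul_re, Complex.mul_im] at *
    nlinarith

lemma CK_zero_left (z a : ℂ) : CK z 0 a := by simp [CK, CW]
lemma CK_zero_right (z a : ℂ) : CK z a 0 := by simp [CK, CW]

lemma CK_refl {z : ℂ} (hz : 0 < z.im) (a : ℂ) : CK z a a := by
  constructor
  · simp only [CW]; nlinarith
  · simp only [CW, Complex.mul_re, Complex.mul_im]
    have : 0 ≤ z.im * (a.re ^ 2 + a.im ^ 2) := by positivity
    nlinarith

lemma CK_sum_left {ι : Type} {z : ℂ} (s : Finset ι) (f : ι → ℂ) (b : ℂ)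
    (h : ∀ i ∈ s, CK z (f i) b) : CK z (∑ i ∈ s, f i) b := by
  induction s using Finset.induction_on with
  | empty => simpa using CK_zero_left z b
  | insert i s hi ih =>
    rw [Finset.sum_insert hi]
    exact CK_add_left (h i (by simp)) (ih fun j hj => h j (by simp [hj]))

lemma CK_sum_right {ι : Type} {z : ℂ} (s : Finset ι) (f : ι → ℂ) (b : ℂ)
    (h : ∀ i ∈ s, CK z b (f i)) : CK z b (∑ i ∈ s, f i) := by
  induction s using Finset.induction_on with
  | empty => simpa using CK_zero_right z b
  | insert i s hi ih =>
    rw [Finset.sum_insert hi]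
    exact CK_add_right (h i (by simp)) (ih fun j hj => h j (by simp [hj]))

lemma CK_step {z A B C : ℂ} (hz : 0 < z.im) (hAB : CK z A B) (hAC : CK z A C) (hBC : CK z B C) :
    CK z (z * A + B + C) (z * A + z * B + C) := by
  obtain ⟨a1, a2⟩ := hAB
  obtain ⟨b1, b2⟩ := hAC
  obtain ⟨c1, c2⟩ := hBC
  have hN : 0 ≤ z.re ^ 2 + z.im ^ 2 := by positivity
  have d1 := mul_nonneg hN a1
  have d2 := mul_nonneg hN a2
  have d3 := mul_nonneg hN c1
  have d4 : 0 ≤ CW B (z * B) := (CK_refl hz B).2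
  have d5 : 0 ≤ CW (z * A + C) (z * (z * A + C)) := (CK_refl hz _).2
  constructor
  · have : CW (z * A + B + C) (z * A + z * B + C) =
      (z.re ^ 2 + z.im ^ 2) * CW A B + CW B (z * A) + CW B (z * B) + CW B C + CW C (z * B) := by
      simp only [CW, Complex.add_re, Complex.add_im, Complex.mul_re, Complex.mul_im]
      ring
    rw [this]; positivity
  · have : CW (z * A + z * B + C) (z * (z * A + B + C)) =
      CW (z * A + C) (z * (z * A + C)) + (z.re ^ 2 + z.im ^ 2) * CW A B + CW C (z * B)
       + (z.re ^ 2 + z.im ^ 2) * CW B (z * A) + (z.re ^ 2 + z.im ^ 2) * CW B C := by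
      simp only [CW, Complex.add_re, Complex.add_im, Complex.mul_re, Complex.mul_im]
      ring
    rw [this]; positivity

lemma CK_step' {z B C : ℂ} (hz : 0 < z.im) (hBC : CK z B C) : CK z (B + C) C :=
  CK_add_left hBC (CK_refl hz C)

lemma CK_ne {z a b : ℂ} (hz : 0 < z.im) (ha : a ≠ 0) (h : CK z a b) : a + b ≠ 0 := by
  intro h0
  have hb : b = -a := by linear_combination h0
  subst hb
  have h2 := h.2
  have : CW (-a) (z * a) = - (z.im * Complex.normSq a) := by
    simp only [CW, Complex.mul_re, Complex.mul_im, Complex.neg_re, Complex.neg_im,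
      Complex.normSq_apply]
    ring
  have h3 := mul_pos hz (Complex.normSq_pos.mpr ha)
  linarith

/-- value of `Q` at `z` -/
def qv (T : Finset ℕ) (n : ℕ) (z : ℂ) (k : Fin (n + 1)) : ℂ := aeval z (Q T n k)

lemma qv_succ (T : Finset ℕ) (n : ℕ) (z : ℂ) (k : Fin (n + 2)) :
    qv T (n + 1) z k = (if n + 1 ∈ T then z else 0) *
        ∑ j ∈ Finset.univ.filter (fun j : Fin (n + 1) => k ≤ j.castSucc), qv T n z j +
      ∑ j ∈ Finset.univ.filter (fun j : Fin (n + 1) => ¬ k ≤ j.castSucc), qv T n z j := by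
  unfold qv
  rw [Q_succ, map_sum, ← Finset.sum_filter_add_sum_filter_not _
    (fun j : Fin (n + 1) => k ≤ j.castSucc), Finset.mul_sum]
  congr 1
  · refine Finset.sum_congr rfl fun j hj => ?_
    rw [if_pos (Finset.mem_filter.mp hj).2, map_mul]
    split_ifs <;> simp
  · refine Finset.sum_congr rfl fun j hj => ?_
    rw [if_neg (Finset.mem_filter.mp hj).2]
    simp

lemma qv_main (T : Finset ℕ) (z : ℂ) (hz : 0 < z.im) (n : ℕ) :
    (∀ k l : Fin (n + 1), l ≤ k → CK z (qv T n z k) (qv T n z l)) ∧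
      qv T n z (Fin.last n) ≠ 0 := by
  induction n with
  | zero =>
    refine ⟨fun k l _ => ?_, ?_⟩
    · have hkl : k = l := Fin.ext (by omega)
      rw [hkl]; exact CK_refl hz _
    · have : descSet (appendPerm (Fin.last 0) (1 : Equiv.Perm (Fin 0))) = ∅ := by
        ext i; simp [mem_descSet]
      have h1 : ∀ w : Equiv.Perm (Fin 0),
          wt T (descSet (appendPerm (Fin.last 0) w)) = 1 := by
        intro w
        rw [Subsingleton.elim w 1, this]; simp [wt]
      unfold qv Q
      simp only [h1]
      simp
  | succ n ih =>
    obtain ⟨ih1, ih2⟩ := ih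
    constructor
    · intro k l hlk
      rw [qv_succ, qv_succ]
      set A := ∑ j ∈ Finset.univ.filter (fun j : Fin (n + 1) => k ≤ j.castSucc), qv T n z j
        with hA
      set B := ∑ j ∈ Finset.univ.filter (fun j : Fin (n + 1) => l ≤ j.castSucc ∧
        ¬ k ≤ j.castSucc), qv T n z j with hB
      set C := ∑ j ∈ Finset.univ.filter (fun j : Fin (n + 1) => ¬ l ≤ j.castSucc), qv T n z j
        with hC
      have e1 : ∑ j ∈ Finset.univ.filter (fun j : Fin (n + 1) => ¬ k ≤ j.castSucc), qv T n z j
          = B + C := by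
        rw [hB, hC, ← Finset.sum_union]
        · refine Finset.sum_congr ?_ fun _ _ => rfl
          ext j
          simp only [Finset.mem_filter, Finset.mem_union, Finset.mem_univ, true_and]
          constructor
          · intro h; by_cases h' : l ≤ j.castSucc <;> tauto
          · rintro (h | h)
            · exact h.2
            · exact fun h' => h (hlk.trans h')
        · rw [Finset.disjoint_filter]; tauto
      have e2 : ∑ j ∈ Finset.univ.filter (fun j : Fin (n + 1) => l ≤ j.castSucc), qv T n z j
          = A + B := by
        rw [hA, hB, ← Finset.sum_union]
        · refine Finset.sum_congr ?_ fun _ _ => rfl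
          ext j
          simp only [Finset.mem_filter, Finset.mem_union, Finset.mem_univ, true_and]
          constructor
          · intro h; by_cases h' : k ≤ j.castSucc <;> tauto
          · rintro (h | h)
            · exact hlk.trans h
            · exact h.1
        · rw [Finset.disjoint_filter]; tauto
      rw [e1, e2]
      have hAB : CK z A B := by
        refine CK_sum_left _ _ _ fun i hi => CK_sum_right _ _ _ fun j hj => ih1 i j ?_
        simp only [Finset.mem_filter, Finset.mem_univ, true_and, not_le, Fin.le_def, Fin.lt_def,
          Fin.val_castSucc] at *
        omega
      have hAC : CK z A C := by
        refine CK_sum_left _ _ _ fun i hi => CK_sum_right _ _ _ fun j hj => ih1 i j ?_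
        simp only [Finset.mem_filter, Finset.mem_univ, true_and, not_le, Fin.le_def, Fin.lt_def,
          Fin.val_castSucc] at *
        omega
      have hBC : CK z B C := by
        refine CK_sum_left _ _ _ fun i hi => CK_sum_right _ _ _ fun j hj => ih1 i j ?_
        simp only [Finset.mem_filter, Finset.mem_univ, true_and, not_le, Fin.le_def, Fin.lt_def,
          Fin.val_castSucc] at *
        omega
      split_ifs
      · have := CK_step hz hAB hAC hBC
        rwa [mul_add, ← add_assoc]
      · simpa using CK_step' hz hBC
    · rw [qv_succ]
      have h1 : Finset.univ.filter (fun j : Fin (n + 1) => Fin.last (n + 1) ≤ j.castSucc) = ∅ := by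
        ext j; simp [Fin.castSucc_lt_last]
      have h2 : Finset.univ.filter (fun j : Fin (n + 1) => ¬ Fin.last (n + 1) ≤ j.castSucc)
          = Finset.univ := by
        ext j; simp [Fin.castSucc_lt_last]
      rw [h1, h2, Finset.sum_empty, mul_zero, zero_add,
        ← Finset.add_sum_erase _ _ (Finset.mem_univ (Fin.last n))]
      exact CK_ne hz ih2 (CK_sum_right _ _ _ fun j _ => ih1 _ _ (Fin.le_last j))

lemma main_cone (n r : ℕ) (hr : 0 < r) (T : Finset ℕ) (z : ℂ) (hz : 0 < z.im) :
    CK z (aeval z (Apoly n T)) (aeval z (Acolored n r T)) ∧ aeval z (Apoly n T) ≠ 0 ∧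
      aeval z (Acolored n r T) ≠ 0 := by
  obtain ⟨h1, h2⟩ := qv_main T z hz n
  obtain ⟨κ, hκ, e⟩ := Acolored_eq n r T
  rw [e, Apoly_eq, map_sum]
  have hk : ∀ f, CK z (qv T n z (Fin.last n)) (qv T n z (κ f)) := fun f => h1 _ _ (Fin.le_last _)
  refine ⟨CK_sum_right _ _ _ fun f _ => hk f, h2, ?_⟩
  let f0 : Fin n → Fin r := fun _ => ⟨0, hr⟩
  rw [← Finset.add_sum_erase _ _ (Finset.mem_univ f0), hκ f0 (fun _ => rfl)]
  exact CK_ne hz h2 (CK_sum_right _ _ _ fun f _ => hk f)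

lemma le_get_iff (L : List ℝ) (hL : L.Pairwise (fun a b => b ≤ a)) (t : ℝ) (i : ℕ)
    (hi : i < L.length) : t ≤ L.get ⟨i, hi⟩ ↔ i < L.countP (fun x => decide (t ≤ x)) := by
  induction L generalizing i with
  | nil => simp at hi
  | cons a L ih =>
    rw [List.pairwise_cons] at hL
    rw [List.countP_cons]
    cases i with
    | zero =>
      simp only [List.get_eq_getElem, List.getElem_cons_zero]
      by_cases h : t ≤ a
      · simp [h]
      · have : L.countP (fun x => decide (t ≤ x)) = 0 := by
          rw [List.countP_eq_zero]
          intro x hx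
          have := hL.1 x hx
          simp only [decide_eq_true_eq]
          linarith
        simp [h, this]
    | succ i =>
      have hi' : i < L.length := by simpa using hi
      have := ih hL.2 i hi'
      simp only [List.get_eq_getElem, List.getElem_cons_succ] at this ⊢
      rw [this]
      by_cases h : t ≤ a
      · simp [h]
      · have : L.countP (fun x => decide (t ≤ x)) = 0 := by
          rw [List.countP_eq_zero]
          intro x hx
          have := hL.1 x hx
          simp only [decide_eq_true_eq]
          linarith
        simp [h, this]

lemma le_rootsDesc_iff (p : Polynomial ℝ) (t : ℝ) (i : ℕ) (hi : i < (rootsDesc p).length) :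
    t ≤ (rootsDesc p).get ⟨i, hi⟩ ↔ i < p.roots.countP (fun x => t ≤ x) := by
  rw [le_get_iff]
  · have : p.roots = ((rootsDesc p : List ℝ) : Multiset ℝ) := by
      unfold rootsDesc
      rw [← Multiset.coe_eq_coe.mpr (List.reverse_perm _).symm, Multiset.sort_eq]
    rw [this, Multiset.coe_countP]
  · unfold rootsDesc
    rw [List.pairwise_reverse]
    exact Multiset.pairwise_sort _ _

lemma length_rootsDesc (p : Polynomial ℝ) : (rootsDesc p).length = Multiset.card p.roots := by
  unfold rootsDesc
  simp

lemma interlaces_of_count (p q : Polynomial ℝ) (hp : RealRooted p) (hq : RealRooted q)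
    (h : ∀ t : ℝ, p.roots.countP (fun x => t ≤ x) ≤ q.roots.countP (fun x => t ≤ x) ∧
      q.roots.countP (fun x => t ≤ x) ≤ p.roots.countP (fun x => t ≤ x) + 1) :
    Interlaces p q := by
  right; right
  obtain ⟨t, ht⟩ : ∃ t : ℝ, ∀ x ∈ p.roots + q.roots, t ≤ x := by
    obtain ⟨t, ht⟩ := (p.roots + q.roots).toFinset.bddBelow
    exact ⟨t, fun x hx => ht (by simpa using hx)⟩
  have hpc : p.roots.countP (fun x => t ≤ x) = Multiset.card p.roots :=
    Multiset.countP_eq_card.mpr fun x hx => ht x (by rw [Multiset.mem_add]; exact Or.inl hx)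
  have hqc : q.roots.countP (fun x => t ≤ x) = Multiset.card q.roots :=
    Multiset.countP_eq_card.mpr fun x hx => ht x (by rw [Multiset.mem_add]; exact Or.inr hx)
  have := h t
  rw [hpc, hqc] at this
  refine ⟨hp, hq, this.2, this.1, ?_, ?_⟩
  · intro i h1 h2
    rw [le_rootsDesc_iff]
    have h3 := (le_rootsDesc_iff p _ i h1).mp le_rfl
    exact lt_of_lt_of_le h3 (h _).1
  · intro i h1 h2
    rw [le_rootsDesc_iff]
    have h3 := (le_rootsDesc_iff q _ (i + 1) h1).mp le_rfl
    have h4 := (h ((rootsDesc q).get ⟨i + 1, h1⟩)).2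
    omega

lemma realRooted_of_upper (p : Polynomial ℝ) (h : ∀ z : ℂ, 0 < z.im → aeval z p ≠ 0) :
    RealRooted p := by
  right
  intro z hz
  by_contra hne
  rcases lt_or_gt_of_ne hne with h1 | h1
  · refine h (starRingEnd ℂ z) (by simpa using h1) ?_
    rw [Polynomial.aeval_conj, hz, map_zero]
  · exact h z h1 hz

lemma splits_of_upper (p : Polynomial ℝ) (h : ∀ z : ℂ, 0 < z.im → aeval z p ≠ 0) :
    p.Splits := by
  have h0 : p ≠ 0 := by
    rintro rfl
    exact h Complex.I (by simp) (by simp)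
  have hR := realRooted_of_upper p h
  rcases hR with hR | hR
  · exact absurd hR h0
  refine Polynomial.splits_iff_splits.mpr (Or.inr ?_)
  intro g hg hgp
  obtain ⟨z, hz⟩ := IsAlgClosed.exists_aeval_eq_zero ℂ g (Polynomial.degree_pos_of_irreducible hg).ne'
  have hpz : aeval z p = 0 := by
    obtain ⟨q, rfl⟩ := hgp
    rw [map_mul, hz, zero_mul]
  have hz' : z = ((z.re : ℝ) : ℂ) := by
    apply Complex.ext <;> simp [hR z hpz]
  have hroot : g.IsRoot z.re := by
    rw [hz'] at hz
    have : aeval ((z.re : ℝ) : ℂ) g = ((g.eval z.re : ℝ) : ℂ) := by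
      rw [← Complex.coe_algebraMap, Polynomial.aeval_algebraMap_apply]
      simp
    rw [this] at hz
    exact_mod_cast hz
  exact Polynomial.degree_eq_one_of_irreducible_of_root hg hroot

/-- total argument -/
def Th (s : Multiset ℝ) (z : ℂ) : ℝ := (s.map fun a : ℝ => (z - (a : ℂ)).arg).sum

lemma prod_polar (s : Multiset ℝ) (z : ℂ) (hz : 0 < z.im) : ∃ R : ℝ, 0 < R ∧
    (s.map fun a : ℝ => (z - (a : ℂ))).prod = (R : ℂ) * Complex.exp (Th s z * Complex.I) := by
  induction s using Multiset.induction_on with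
  | empty => exact ⟨1, one_pos, by simp [Th]⟩
  | cons a s ih =>
    obtain ⟨R, hR, h⟩ := ih
    have hne : z - (a : ℂ) ≠ 0 := by
      intro h0
      have := congrArg Complex.im h0
      simp at this
      exact hz.ne' this
    refine ⟨‖z - (a : ℂ)‖ * R, mul_pos (norm_pos_iff.mpr hne) hR, ?_⟩
    rw [Multiset.map_cons, Multiset.prod_cons, h]
    conv_lhs => rw [← Complex.norm_mul_exp_arg_mul_I (z - (a : ℂ))]
    have : Th (a ::ₘ s) z = (z - (a : ℂ)).arg + Th s z := by simp [Th]
    rw [this]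
    push_cast
    rw [add_mul, Complex.exp_add]
    ring

lemma poly_polar (p : Polynomial ℝ) (hp : p.Splits) (hl : 0 < p.leadingCoeff) (z : ℂ)
    (hz : 0 < z.im) : ∃ R : ℝ, 0 < R ∧
    aeval z p = (R : ℂ) * Complex.exp (Th p.roots z * Complex.I) := by
  obtain ⟨R, hR, h⟩ := prod_polar p.roots z hz
  refine ⟨p.leadingCoeff * R, mul_pos hl hR, ?_⟩
  have e := congrArg (aeval z) hp.eq_prod_roots
  rw [e, map_mul, map_multiset_prod, Multiset.map_map]
  simp only [Function.comp_def, map_sub, aeval_X, aeval_C, Complex.coe_algebraMap]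
  rw [h]
  push_cast
  ring

lemma CW_polar (R S a b : ℝ) : CW ((R : ℂ) * Complex.exp (a * Complex.I))
    ((S : ℂ) * Complex.exp (b * Complex.I)) = R * S * Real.sin (b - a) := by
  simp only [CW, Complex.re_ofReal_mul, Complex.im_ofReal_mul, Complex.exp_ofReal_mul_I_re,
    Complex.exp_ofReal_mul_I_im, Real.sin_sub]
  ring

lemma Th_cont (s : Multiset ℝ) : ContinuousOn (Th s) {z : ℂ | 0 < z.im} := by
  induction s using Multiset.induction_on with
  | empty =>
    have : Th 0 = fun _ => 0 := by funext z; simp [Th]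
    rw [this]
    exact continuousOn_const
  | cons a s ih =>
    have : Th (a ::ₘ s) = fun z => (z - (a : ℂ)).arg + Th s z := by
      funext z; simp [Th]
    rw [this]
    refine ContinuousOn.add ?_ ih
    intro z hz
    have h1 : ContinuousAt Complex.arg (z - (a : ℂ)) :=
      Complex.continuousAt_arg (Or.inr (by simpa using (ne_of_gt hz)))
    exact (ContinuousAt.comp (f := fun z : ℂ => z - (a : ℂ)) h1
      (by fun_prop)).continuousWithinAt

lemma Th_lim (s : Multiset ℝ) (t : ℝ) (ht : t ∉ s) :
    Filter.Tendsto (fun e : ℝ => Th s ((t : ℂ) + e * Complex.I)) (nhdsWithin 0 (Set.Ioi 0))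
      (nhds (Real.pi * (s.countP (fun x => t ≤ x) : ℕ))) := by
  induction s using Multiset.induction_on with
  | empty => simp [Th]
  | cons a s ih =>
    have ha : t ≠ a := fun h => ht (by simp [h])
    have ih := ih (fun h => ht (by simp [h]))
    have : ∀ z, Th (a ::ₘ s) z = (z - (a : ℂ)).arg + Th s z := by
      intro z; simp [Th]
    simp only [this]
    have hmap : Filter.Tendsto (fun e : ℝ => ((t : ℂ) + e * Complex.I - (a : ℂ)))
        (nhdsWithin 0 (Set.Ioi 0))
        (nhdsWithin (((t - a : ℝ) : ℂ)) {z : ℂ | 0 ≤ z.im}) := by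
      rw [tendsto_nhdsWithin_iff]
      constructor
      · have hc : Continuous (fun e : ℝ => ((t : ℂ) + e * Complex.I - (a : ℂ))) := by fun_prop
        have := hc.tendsto 0
        simp only [Complex.ofReal_zero, zero_mul, add_zero] at this
        rw [Complex.ofReal_sub]
        exact this.mono_left nhdsWithin_le_nhds
      · filter_upwards [self_mem_nhdsWithin] with e he
        have : (0 : ℝ) < e := he
        simpa using this.le
    rw [Multiset.countP_cons]
    rcases lt_or_gt_of_ne ha with h | h
    · rw [if_pos h.le]
      have hc : ContinuousWithinAt Complex.arg {z : ℂ | 0 ≤ z.im} ((t - a : ℝ) : ℂ) :=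
        Complex.continuousWithinAt_arg_of_re_neg_of_im_zero (by simpa using h) (by simp)
      have h2 := (hc.tendsto.comp hmap).add ih
      rw [Complex.arg_ofReal_of_neg (by linarith)] at h2
      refine h2.congr' (Filter.Eventually.of_forall fun _ => rfl) |>.trans (le_of_eq ?_)
      congr 1
      push_cast; ring
    · rw [if_neg (not_le.mpr h)]
      have hc : ContinuousAt Complex.arg ((t - a : ℝ) : ℂ) :=
        Complex.continuousAt_arg (Or.inl (by simpa using h))
      have h2 := (hc.continuousWithinAt.tendsto.comp hmap).add ih
      rw [Complex.arg_ofReal_of_nonneg (by linarith)] at h2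
      refine h2.congr' (Filter.Eventually.of_forall fun _ => rfl) |>.trans (le_of_eq ?_)
      congr 1
      push_cast; ring

lemma Th_lim2 (s u : Multiset ℝ) (t : ℝ) (hs : t ∉ s) (hu : t ∉ u) :
    Filter.Tendsto (fun e : ℝ => Th u ((t : ℂ) + e * Complex.I) - Th s ((t : ℂ) + e * Complex.I))
      (nhdsWithin 0 (Set.Ioi 0))
      (nhds (Real.pi * ((u.countP (fun x => t ≤ x) : ℕ) : ℝ) -
        Real.pi * ((s.countP (fun x => t ≤ x) : ℕ) : ℝ))) :=
  (Th_lim u t hu).sub (Th_lim s t hs)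

lemma Th_bound (s u : Multiset ℝ)
    (h : ∀ z : ℂ, 0 < z.im → 0 ≤ Real.sin (Th u z - Th s z)) (z : ℂ) (hz : 0 < z.im) :
    0 ≤ Th u z - Th s z ∧ Th u z - Th s z ≤ Real.pi := by
  have hpi := Real.pi_gt_three
  have hpre : IsPreconnected ((fun z => Th u z - Th s z) '' {z : ℂ | 0 < z.im}) :=
    (convex_halfSpace_im_gt 0).isPreconnected.image _ ((Th_cont u).sub (Th_cont s))
  have hord := hpre.ordConnected
  -- a starting point
  obtain ⟨z0, hz0, h0, h1⟩ : ∃ z0 : ℂ, 0 < z0.im ∧ 0 ≤ Th u z0 - Th s z0 ∧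
      Th u z0 - Th s z0 < 1 := by
    obtain ⟨t, ht⟩ : ∃ t : ℝ, ∀ x ∈ s + u, x < t := by
      obtain ⟨t, ht⟩ := (s + u).toFinset.bddAbove
      exact ⟨t + 1, fun x hx => lt_of_le_of_lt (ht (by simpa using hx)) (by linarith)⟩
    have hs : ∀ x ∈ s, ¬ t ≤ x := fun x hx =>
      not_le.mpr (ht x (by rw [Multiset.mem_add]; exact Or.inl hx))
    have hu : ∀ x ∈ u, ¬ t ≤ x := fun x hx =>
      not_le.mpr (ht x (by rw [Multiset.mem_add]; exact Or.inr hx))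
    have hl := Th_lim2 s u t (fun hx => hs t hx le_rfl) (fun hx => hu t hx le_rfl)
    rw [Multiset.countP_eq_zero.mpr hs, Multiset.countP_eq_zero.mpr hu] at hl
    simp only [Nat.cast_zero, mul_zero, sub_zero] at hl
    have hev := hl.eventually (Ioo_mem_nhds (show (-1 : ℝ) < 0 by norm_num) one_pos)
    obtain ⟨e, ⟨he1, he2⟩, he⟩ := (hev.and self_mem_nhdsWithin).exists
    have he : (0 : ℝ) < e := he
    have him : 0 < ((t : ℂ) + e * Complex.I).im := by simpa using he
    refine ⟨_, him, ?_, he2⟩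
    by_contra hneg
    have := Real.sin_neg_of_neg_of_neg_pi_lt (not_le.mp hneg) (by linarith)
    linarith [h _ him]
  have hmem : ∀ y, y ∈ ((fun z => Th u z - Th s z) '' {z : ℂ | 0 < z.im}) → 0 ≤ Real.sin y := by
    rintro y ⟨w, hw, rfl⟩
    exact h w hw
  have m0 : Th u z0 - Th s z0 ∈ ((fun z => Th u z - Th s z) '' {z : ℂ | 0 < z.im}) :=
    ⟨z0, hz0, rfl⟩
  have m1 : Th u z - Th s z ∈ ((fun z => Th u z - Th s z) '' {z : ℂ | 0 < z.im}) :=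
    ⟨z, hz, rfl⟩
  generalize Th u z0 - Th s z0 = y0 at *
  generalize Th u z - Th s z = y at *
  constructor
  · by_contra hneg
    have hneg := not_le.mp hneg
    have hm : max y (-1) ∈ ((fun z => Th u z - Th s z) '' {z : ℂ | 0 < z.im}) :=
      hord.out m1 m0 ⟨le_max_left _ _, max_le (by linarith) (by linarith)⟩
    have h2 := hmem _ hm
    have h3 := Real.sin_neg_of_neg_of_neg_pi_lt (x := max y (-1))
      (max_lt hneg (by norm_num)) (lt_of_lt_of_le (by linarith) (le_max_right _ _))
    linarith
  · by_contra hneg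
    have hneg := not_le.mp hneg
    have hm : min y (Real.pi + 1) ∈ ((fun z => Th u z - Th s z) '' {z : ℂ | 0 < z.im}) :=
      hord.out m0 m1 ⟨le_min (by linarith) (by linarith), min_le_left _ _⟩
    have h2 := hmem _ hm
    have h4 : Real.pi < min y (Real.pi + 1) := lt_min hneg (by linarith)
    have h5 : min y (Real.pi + 1) ≤ Real.pi + 1 := min_le_right _ _
    have h3 := Real.sin_pos_of_pos_of_lt_pi (x := min y (Real.pi + 1) - Real.pi)
      (by linarith) (by linarith)
    rw [Real.sin_sub_pi] at h3
    linarith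

lemma count_bound (s u : Multiset ℝ)
    (h : ∀ z : ℂ, 0 < z.im → 0 ≤ Real.sin (Th u z - Th s z)) (t : ℝ) :
    s.countP (fun x => t ≤ x) ≤ u.countP (fun x => t ≤ x) ∧
      u.countP (fun x => t ≤ x) ≤ s.countP (fun x => t ≤ x) + 1 := by
  have hpi := Real.pi_pos
  -- nudge `t` to the left
  obtain ⟨t', ht', hgap⟩ : ∃ t' < t, ∀ x ∈ s + u, x < t → x < t' := by
    obtain ⟨m, hm⟩ : ∃ m < t, ∀ x ∈ s + u, x < t → x ≤ m := by
      induction (s + u) using Multiset.induction_on with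
      | empty => exact ⟨t - 1, by linarith, by simp⟩
      | cons a v ih =>
        obtain ⟨m, hm, hv⟩ := ih
        by_cases ha : a < t
        · refine ⟨max a m, max_lt ha hm, fun x hx hxt => ?_⟩
          rcases Multiset.mem_cons.mp hx with rfl | hx
          · exact le_max_left _ _
          · exact (hv x hx hxt).trans (le_max_right _ _)
        · refine ⟨m, hm, fun x hx hxt => ?_⟩
          rcases Multiset.mem_cons.mp hx with rfl | hx
          · exact absurd hxt ha
          · exact hv x hx hxt
    exact ⟨(m + t) / 2, by linarith [hm.1], fun x hx hxt => by linarith [hm.2 x hx hxt, hm.1]⟩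
  have hiff : ∀ x ∈ s + u, (t ≤ x ↔ t' ≤ x) := fun x hx =>
    ⟨fun h => ht'.le.trans h, fun h => by
      by_contra hc
      exact absurd (hgap x hx (not_le.mp hc)) (not_lt.mpr h)⟩
  have hms : ∀ x ∈ s, x ∈ s + u := fun x hx => by rw [Multiset.mem_add]; exact Or.inl hx
  have hmu : ∀ x ∈ u, x ∈ s + u := fun x hx => by rw [Multiset.mem_add]; exact Or.inr hx
  have e1 : s.countP (fun x => t ≤ x) = s.countP (fun x => t' ≤ x) :=
    Multiset.countP_congr rfl fun x hx => by simpa using hiff x (hms x hx)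
  have e2 : u.countP (fun x => t ≤ x) = u.countP (fun x => t' ≤ x) :=
    Multiset.countP_congr rfl fun x hx => by simpa using hiff x (hmu x hx)
  have hn : t' ∉ s + u := fun hx => lt_irrefl _ (hgap t' hx ht')
  rw [e1, e2]
  have hl := Th_lim2 s u t' (fun hx => hn (hms _ hx)) (fun hx => hn (hmu _ hx))
  have hb : ∀ᶠ e : ℝ in nhdsWithin 0 (Set.Ioi 0),
      Th u ((t' : ℂ) + e * Complex.I) - Th s ((t' : ℂ) + e * Complex.I) ∈ Set.Icc 0 Real.pi := by
    filter_upwards [self_mem_nhdsWithin] with e he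
    have he : (0 : ℝ) < e := he
    exact Th_bound s u h _ (by simpa using he)
  have := isClosed_Icc.mem_of_tendsto hl hb
  rw [← mul_sub] at this
  obtain ⟨h1, h2⟩ := this
  have h3 := nonneg_of_mul_nonneg_right h1 hpi
  have h4 : (((u.countP (fun x => t' ≤ x) : ℕ) : ℝ) - (s.countP (fun x => t' ≤ x) : ℕ)) ≤ 1 := by
    by_contra hc
    have := mul_lt_mul_of_pos_left (not_le.mp hc) hpi
    linarith
  constructor
  · have : ((s.countP (fun x => t' ≤ x) : ℕ) : ℝ) ≤ (u.countP (fun x => t' ≤ x) : ℕ) := by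
      linarith
    exact_mod_cast this
  · have : ((u.countP (fun x => t' ≤ x) : ℕ) : ℝ) ≤ (s.countP (fun x => t' ≤ x) : ℕ) + 1 := by
      linarith
    exact_mod_cast this

lemma lc_pos {ι : Type} (s : Finset ι) (d : ι → ℕ)
    (h : (∑ i ∈ s, (X : Polynomial ℝ) ^ d i) ≠ 0) :
    0 < (∑ i ∈ s, (X : Polynomial ℝ) ^ d i).leadingCoeff := by
  refine lt_of_le_of_ne ?_ (Ne.symm (leadingCoeff_ne_zero.mpr h))
  unfold Polynomial.leadingCoeff
  generalize (∑ i ∈ s, (X : Polynomial ℝ) ^ d i).natDegree = m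
  rw [finsetSum_coeff]
  refine Finset.sum_nonneg fun i _ => ?_
  rw [coeff_X_pow]
  split_ifs <;> norm_num

/-- For all positive integers `n, r` and every `T ⊆ [n]`, the polynomial
`A^T_{n,r}(x)` is real-rooted and is interlaced by `A^T_n(x)`. -/
theorem stmt14 (n r : ℕ) (hn : 0 < n) (hr : 0 < r) (T : Finset ℕ)
    (hT : T ⊆ Finset.Icc 1 n) :
    RealRooted (Acolored n r T) ∧ Interlaces (Apoly n T) (Acolored n r T) := by

  have hmain := fun z hz => main_cone n r hr T z hz
  have hA := fun z hz => (hmain z hz).2.1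
  have hC := fun z hz => (hmain z hz).2.2
  have rA := realRooted_of_upper _ hA
  have rC := realRooted_of_upper _ hC
  have sA := splits_of_upper _ hA
  have sC := splits_of_upper _ hC
  have nA : Apoly n T ≠ 0 := fun h => hA Complex.I (by simp) (by rw [h, map_zero])
  have nC : Acolored n r T ≠ 0 := fun h => hC Complex.I (by simp) (by rw [h, map_zero])
  have lA : 0 < (Apoly n T).leadingCoeff := lc_pos _ _ nA
  have lC : 0 < (Acolored n r T).leadingCoeff := lc_pos _ _ nC
  refine ⟨rC, interlaces_of_count _ _ rA rC (count_bound _ _ fun z hz => ?_)⟩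
  obtain ⟨R, hR, eR⟩ := poly_polar _ sA lA z hz
  obtain ⟨S, hS, eS⟩ := poly_polar _ sC lC z hz
  have h1 := (hmain z hz).1.1
  rw [eR, eS, CW_polar] at h1
  exact nonneg_of_mul_nonneg_right h1 (mul_pos hR hS)
end
end

section
/- For all positive integers n and r ≥ 1, the polynomial E_{n,r}(x) = Σ_{w ∈ [r]^n} x^{des(w)} is real-rooted. -/
open Polynomial

open scoped Classical

noncomputable section

/-- The descent set of a word `w ∈ [r]^n` (encoded as `w : Fin n → Fin r`), as a subset
of `{1,…,n-1}` (1-based): `i` is a descent iff `w(i) ≥ w(i+1)`. -/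
def descSetW {n r : ℕ} (w : Fin n → Fin r) : Finset ℕ :=
  (Finset.univ.filter (fun i : Fin (n - 1) =>
      w ⟨i.val + 1, by have := i.isLt; omega⟩ ≤ w ⟨i.val, by have := i.isLt; omega⟩)).image
    (fun i => i.val + 1)

/-- `E_{n,r}(x) = Σ_{w ∈ [r]^n} x^{des(w)}`. -/
def Epoly (n r : ℕ) : Polynomial ℝ :=
  ∑ w : Fin n → Fin r, X ^ (descSetW w).card

/-- The set `D_{n,k}` of words `w ∈ ℤ^k` such that `(|w(1)|, w(2), …, w(k)) ∈ [n-1]^k`. -/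
def Dword (n k : ℕ) : Finset (Fin k → ℤ) :=
  (Fintype.piFinset (fun _ : Fin k => Finset.Icc (-(n : ℤ)) (n : ℤ))).filter
    (fun w => ∀ i : Fin k,
      (i.val = 0 → 1 ≤ |w i| ∧ |w i| ≤ (n : ℤ) - 1) ∧
      (i.val ≠ 0 → 1 ≤ w i ∧ w i ≤ (n : ℤ) - 1))

/-- The descent set of a word `w ∈ D_{n,k} ⊆ ℤ^k`, as a subset of `{1,…,k-1}`
(1-based): `i` is a descent iff `|w(i)| > w(i+1)`, or `w(i) = w(i+1) > 0`. -/
def descSetD {k : ℕ} (w : Fin k → ℤ) : Finset ℕ :=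
  (Finset.univ.filter (fun i : Fin (k - 1) =>
      w ⟨i.val + 1, by have := i.isLt; omega⟩ < |w ⟨i.val, by have := i.isLt; omega⟩| ∨
        (w ⟨i.val, by have := i.isLt; omega⟩ = w ⟨i.val + 1, by have := i.isLt; omega⟩ ∧
          0 < w ⟨i.val + 1, by have := i.isLt; omega⟩))).image (fun i => i.val + 1)

namespace EProof

lemma tel (n M a : ℕ) : ∑ j ∈ Finset.range a, ((M + (a - 1 - j)).choose n : ℝ)
    = ((M + a).choose (n + 1) : ℝ) - (M.choose (n + 1) : ℝ) := by
  rw [Finset.sum_range_reflect (fun j => ((M + j).choose n : ℝ))]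
  induction a with
  | zero => simp
  | succ a ih =>
    rw [Finset.sum_range_succ, ih, ← add_assoc, Nat.choose_succ_succ]
    push_cast
    ring

lemma comb1 (n N r k : ℕ) (hk : k < r) :
    ∑ j ∈ Finset.range r, (if j ≤ k then ((N + (r - 1 - j)).choose n : ℝ)
      else ((N + r + (r - 1 - j)).choose n : ℝ))
    = ((N + r + (r - 1 - k)).choose (n + 1) : ℝ) - ((N + (r - 1 - k)).choose (n + 1) : ℝ) := by
  obtain ⟨s, rfl⟩ : ∃ s, r = (k + 1) + s := ⟨r - (k + 1), by omega⟩
  rw [Finset.sum_range_add]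
  have h1 := tel n (N + s) (k + 1)
  have h2 := tel n (N + (k + 1 + s)) s
  have e1 : ∑ j ∈ Finset.range (k + 1), (if j ≤ k then ((N + (k + 1 + s - 1 - j)).choose n : ℝ)
      else ((N + (k + 1 + s) + (k + 1 + s - 1 - j)).choose n : ℝ))
      = ∑ j ∈ Finset.range (k + 1), ((N + s + (k + 1 - 1 - j)).choose n : ℝ) := by
    refine Finset.sum_congr rfl fun j hj => ?_
    rw [Finset.mem_range] at hj
    rw [if_pos (by omega)]
    congr 2
    omega
  have e2 : ∑ j ∈ Finset.range s, (if (k + 1) + j ≤ k then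
      ((N + (k + 1 + s - 1 - (k + 1 + j))).choose n : ℝ)
      else ((N + (k + 1 + s) + (k + 1 + s - 1 - (k + 1 + j))).choose n : ℝ))
      = ∑ j ∈ Finset.range s, ((N + (k + 1 + s) + (s - 1 - j)).choose n : ℝ) := by
    refine Finset.sum_congr rfl fun j hj => ?_
    rw [Finset.mem_range] at hj
    rw [if_neg (by omega)]
    congr 2
    omega
  rw [e1, e2, h1, h2]
  have e3 : k + 1 + s - 1 - k = s := by omega
  have e4 : N + s + (k + 1) = N + (k + 1 + s) := by omega
  rw [e3, e4]
  ring

lemma comb0 (n r k : ℕ) (hk : k < r) :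
    ∑ j ∈ Finset.range r, (if j ≤ k then (0 : ℝ) else ((r - 1 - j).choose n : ℝ))
    = ((r - 1 - k).choose (n + 1) : ℝ) := by
  obtain ⟨s, rfl⟩ : ∃ s, r = (k + 1) + s := ⟨r - (k + 1), by omega⟩
  rw [Finset.sum_range_add]
  have h2 := tel n 0 s
  have e1 : ∑ j ∈ Finset.range (k + 1), (if j ≤ k then (0 : ℝ)
      else ((k + 1 + s - 1 - j).choose n : ℝ)) = 0 := by
    refine Finset.sum_eq_zero fun j hj => ?_
    rw [Finset.mem_range] at hj
    rw [if_pos (by omega)]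
  have e2 : ∑ j ∈ Finset.range s, (if (k + 1) + j ≤ k then (0 : ℝ)
      else ((k + 1 + s - 1 - (k + 1 + j)).choose n : ℝ))
      = ∑ j ∈ Finset.range s, ((0 + (s - 1 - j)).choose n : ℝ) := by
    refine Finset.sum_congr rfl fun j hj => ?_
    rw [Finset.mem_range] at hj
    rw [if_neg (by omega)]
    congr 2
    omega
  rw [e1, e2, h2]
  have e3 : k + 1 + s - 1 - k = s := by omega
  rw [e3]
  simp

/-- generating series of words following first letter `k` -/
def PS (r n k : ℕ) : PowerSeries ℝ :=
  PowerSeries.mk fun m => ((r * m + (r - 1 - k)).choose n : ℝ)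

lemma PS_rec (r n k : ℕ) (hk : k < r) :
    ∑ j ∈ Finset.range r, (if j ≤ k then PowerSeries.X else 1) * PS r n j
      = (1 - PowerSeries.X) * PS r (n + 1) k := by
  ext m
  rw [map_sum, sub_mul, one_mul, map_sub]
  cases m with
  | zero =>
    rw [PowerSeries.coeff_zero_X_mul]
    simp only [PS, PowerSeries.coeff_mk, mul_zero, zero_add, sub_zero]
    rw [← comb0 n r k hk]
    refine Finset.sum_congr rfl fun j _ => ?_
    split_ifs
    · rw [PowerSeries.coeff_zero_X_mul]
    · simp
  | succ m =>
    rw [PowerSeries.coeff_succ_X_mul]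
    simp only [PS, PowerSeries.coeff_mk]
    rw [mul_add, mul_one, ← comb1 n (r * m) r k hk]
    refine Finset.sum_congr rfl fun j _ => ?_
    split_ifs
    · rw [PowerSeries.coeff_succ_X_mul, PowerSeries.coeff_mk]
    · rw [one_mul, PowerSeries.coeff_mk, mul_add, mul_one]

/-- sum of the `PS` -/
def QS (r n : ℕ) : PowerSeries ℝ :=
  PowerSeries.mk fun m => ((r * (m + 1)).choose n : ℝ)

lemma PS_sum (r n : ℕ) (hr : 0 < r) :
    ∑ j ∈ Finset.range r, PS r n j = (1 - PowerSeries.X) * QS r (n + 1) := by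
  ext m
  rw [map_sum, sub_mul, one_mul, map_sub]
  have h : ∀ m, ∑ j ∈ Finset.range r, PowerSeries.coeff m (PS r n j)
      = ((r * m + r).choose (n + 1) : ℝ) - ((r * m).choose (n + 1) : ℝ) := by
    intro m
    rw [← tel]
    simp only [PS, PowerSeries.coeff_mk]
  rw [h]
  cases m with
  | zero =>
    rw [PowerSeries.coeff_zero_X_mul]
    simp [QS]
  | succ m =>
    rw [PowerSeries.coeff_succ_X_mul]
    simp only [QS, PowerSeries.coeff_mk]
    rfl

lemma QS_rec (r n : ℕ) : ((n : PowerSeries ℝ) + 1) * QS r (n + 1)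
    = (r : PowerSeries ℝ) * (QS r n + PowerSeries.X * PowerSeries.derivative ℝ (QS r n))
      - (n : PowerSeries ℝ) * QS r n := by
  have hX : PowerSeries.X * PowerSeries.derivative ℝ (QS r n)
      = PowerSeries.mk fun m => (m : ℝ) * ((r * (m + 1)).choose n : ℝ) := by
    ext m
    cases m with
    | zero => rw [PowerSeries.coeff_zero_X_mul]; simp
    | succ m =>
      rw [PowerSeries.coeff_succ_X_mul, PowerSeries.coeff_derivative]
      simp only [QS, PowerSeries.coeff_mk]
      push_cast
      ring
  rw [hX]
  have hc : ∀ k : ℕ, (k : PowerSeries ℝ) = PowerSeries.C (k : ℝ) := fun k => by simp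
  rw [hc, hc, add_mul, one_mul]
  ext m
  simp only [map_sub, map_add, PowerSeries.coeff_C_mul, QS, PowerSeries.coeff_mk]
  have h : (((r * (m + 1)).choose (n + 1) : ℕ) : ℝ) * (n + 1)
      = ((r * (m + 1)).choose n : ℝ) * ((r * (m + 1) : ℕ) - n : ℝ) := by
    rcases le_or_gt n (r * (m + 1)) with hle | hlt
    · rw [← Nat.cast_sub hle]
      exact_mod_cast Nat.choose_succ_right_eq (r * (m + 1)) n
    · rw [Nat.choose_eq_zero_of_lt hlt, Nat.choose_eq_zero_of_lt (by omega)]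
      simp
  push_cast at h
  linear_combination h

lemma card_desc {n r : ℕ} (w : Fin (n + 1) → Fin r) :
    (descSetW w).card = ∑ i : Fin n, if w i.succ ≤ w i.castSucc then 1 else 0 := by
  unfold descSetW
  rw [Finset.card_image_of_injective _ (by
    intro a b h
    simp only [Nat.add_right_cancel_iff] at h
    exact Fin.ext h)]
  rw [Finset.card_filter]
  rfl

/-- words starting with the letter `a` -/
def Fp (r n : ℕ) (a : Fin r) : Polynomial ℝ :=
  ∑ w : Fin n → Fin r, X ^ (descSetW (Fin.cons a w : Fin (n + 1) → Fin r)).card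

lemma E_eq (n r : ℕ) : Epoly (n + 1) r = ∑ a : Fin r, Fp r n a := by
  unfold Epoly Fp
  rw [← (Fin.consEquiv (fun _ : Fin (n + 1) => Fin r)).sum_comp, Fintype.sum_prod_type]
  rfl

lemma Fp_zero (r : ℕ) (a : Fin r) : Fp r 0 a = 1 := by
  simp [Fp, card_desc]

lemma Fp_succ (r n : ℕ) (a : Fin r) :
    Fp r (n + 1) a = ∑ b : Fin r, (if b ≤ a then X else 1) * Fp r n b := by
  unfold Fp
  rw [← (Fin.consEquiv (fun _ : Fin (n + 1) => Fin r)).sum_comp, Fintype.sum_prod_type]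
  refine Finset.sum_congr rfl fun b _ => ?_
  rw [Finset.mul_sum]
  refine Finset.sum_congr rfl fun w _ => ?_
  simp only [Fin.consEquiv, Equiv.coe_fn_mk]
  rw [card_desc, card_desc, Fin.sum_univ_succ, pow_add]
  congr 1
  simp only [Fin.cons_succ, Fin.cons_zero, Fin.castSucc_zero]
  split_ifs <;> simp

lemma Fp_series (r n : ℕ) (a : Fin r) :
    (Fp r n a : PowerSeries ℝ) = (1 - PowerSeries.X) ^ (n + 1) * PS r n a := by
  induction n generalizing a with
  | zero =>
    rw [Fp_zero]
    simp only [PS, Nat.choose_zero_right, zero_add, pow_one, Nat.cast_one, Polynomial.coe_one]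
    rw [mul_comm]
    exact (PowerSeries.mk_one_mul_one_sub_eq_one ℝ).symm
  | succ n ih =>
    rw [Fp_succ]
    have h : ((∑ b : Fin r, (if b ≤ a then X else 1) * Fp r n b : Polynomial ℝ) : PowerSeries ℝ)
        = ∑ b : Fin r, (if (b : ℕ) ≤ a then PowerSeries.X else 1)
            * ((1 - PowerSeries.X) ^ (n + 1) * PS r n b) := by
      rw [← Polynomial.coeToPowerSeries.ringHom_apply, map_sum]
      refine Finset.sum_congr rfl fun b _ => ?_
      rw [Polynomial.coeToPowerSeries.ringHom_apply, Polynomial.coe_mul, ih]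
      congr 1
      simp only [Fin.le_def]
      split_ifs <;> simp
    rw [h, Fin.sum_univ_eq_sum_range (fun b => (if b ≤ (a : ℕ) then PowerSeries.X else 1)
            * ((1 - PowerSeries.X) ^ (n + 1) * PS r n b)) r, pow_succ _ (n + 1), mul_assoc,
            ← PS_rec r n a a.isLt, Finset.mul_sum]
    refine Finset.sum_congr rfl fun b _ => ?_
    ring

lemma E_series (r n : ℕ) (hr : 0 < r) :
    (Epoly (n + 1) r : PowerSeries ℝ) = (1 - PowerSeries.X) ^ (n + 2) * QS r (n + 1) := by
  rw [E_eq, ← Polynomial.coeToPowerSeries.ringHom_apply, map_sum]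
  simp only [Polynomial.coeToPowerSeries.ringHom_apply, Fp_series]
  rw [Fin.sum_univ_eq_sum_range (fun b => (1 - PowerSeries.X) ^ (n + 1) * PS r n b) r,
    ← Finset.mul_sum, PS_sum r n hr]
  ring

lemma E_rec (r n : ℕ) (hr : 0 < r) (hn : 0 < n) :
    ((n : Polynomial ℝ) + 1) * Epoly (n + 1) r =
      ((r : Polynomial ℝ) - (n : Polynomial ℝ) + ((r : Polynomial ℝ) * (n : Polynomial ℝ) + (n : Polynomial ℝ)) * X) * Epoly n r
        + (r : Polynomial ℝ) * X * (1 - X) * derivative (Epoly n r) := by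
  obtain ⟨n, rfl⟩ : ∃ k, n = k + 1 := ⟨n - 1, by omega⟩
  apply Polynomial.coe_injective ℝ
  have hD : ((derivative (Epoly (n + 1) r) : Polynomial ℝ) : PowerSeries ℝ)
      = -((n : PowerSeries ℝ) + 2) * (1 - PowerSeries.X) ^ (n + 1) * QS r (n + 1)
        + (1 - PowerSeries.X) ^ (n + 2) * PowerSeries.derivative ℝ (QS r (n + 1)) := by
    rw [← PowerSeries.derivative_coe, E_series r n hr, Derivation.leibniz,
      PowerSeries.derivative_pow, map_sub, PowerSeries.derivative_X, PowerSeries.derivative_one]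
    simp only [smul_eq_mul, Nat.add_sub_cancel]
    push_cast
    ring
  have hq := QS_rec r (n + 1)
  have hc : ∀ k : ℕ, ((k : Polynomial ℝ) : PowerSeries ℝ) = (k : PowerSeries ℝ) := fun k => by
    rw [← Polynomial.coeToPowerSeries.ringHom_apply, map_natCast]
  have hs : ∀ p q : Polynomial ℝ, ((p - q : Polynomial ℝ) : PowerSeries ℝ) = p - q := fun p q => by
    simp only [← Polynomial.coeToPowerSeries.ringHom_apply, map_sub]
  simp only [Polynomial.coe_mul, Polynomial.coe_add, hs, hc, Polynomial.coe_X, Polynomial.coe_one,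
    hD, E_series r n hr, E_series r (n + 1) hr]
  push_cast at hq ⊢
  linear_combination (1 - PowerSeries.X) ^ (n + 3) * hq

lemma logder (z : ℂ) (hz : z.im ≠ 0) (s : Multiset ℝ) (hs : ∀ a ∈ s, a ≤ 0) :
    ∃ (A : ℂ) (t : ℝ),
      aeval z (derivative (s.map (fun a => (X - C a : ℝ[X]))).prod) * (z - 1)
        = aeval z (s.map (fun a => (X - C a : ℝ[X]))).prod * A ∧
      A.im = z.im * t ∧ 0 ≤ t ∧ (t = 0 → A = 0) := by
  induction s using Multiset.induction_on with
  | empty => exact ⟨0, 0, by simp⟩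
  | cons a s ih =>
    obtain ⟨A, t, h1, h2, h3, -⟩ := ih fun b hb => hs b (Multiset.mem_cons_of_mem hb)
    have ha : a ≤ 0 := hs a (Multiset.mem_cons_self a s)
    have hne : z - (a : ℂ) ≠ 0 := by
      intro h
      apply hz
      have := congrArg Complex.im h
      simpa using this
    have hpos : 0 < (1 - a) / Complex.normSq (z - a) :=
      div_pos (by linarith) (Complex.normSq_pos.2 hne)
    refine ⟨(z - 1) / (z - a) + A, (1 - a) / Complex.normSq (z - a) + t, ?_, ?_, by positivity,
      fun h => absurd h (by positivity)⟩
    · simp only [Multiset.map_cons, Multiset.prod_cons, derivative_mul, derivative_sub,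
        derivative_X, derivative_C, sub_zero, one_mul, map_add, map_mul, map_sub, aeval_X, aeval_C,
        Complex.coe_algebraMap]
      rw [add_mul, mul_assoc, h1]
      field_simp
    · rw [Complex.add_im, h2, Complex.div_im]
      simp only [Complex.sub_im, Complex.sub_re, Complex.one_im, Complex.one_re, Complex.ofReal_im,
        Complex.ofReal_re]
      ring

lemma step_ne (n r m : ℕ) (hr : 0 < r) (hm : n ≤ r * (m + 1)) (c : ℝ) (hc : c ≠ 0)
    (s : Multiset ℝ) (hs : ∀ a ∈ s, a ≤ 0) (P Q : ℝ[X])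
    (hP : P = C c * X ^ m * (s.map (fun a => (X - C a : ℝ[X]))).prod)
    (hQ : ((n : ℝ[X]) + 1) * Q =
      ((r : ℝ[X]) - (n : ℝ[X]) + ((r : ℝ[X]) * (n : ℝ[X]) + (n : ℝ[X])) * X) * P
        + (r : ℝ[X]) * X * (1 - X) * derivative P) (z : ℂ) (hQz : aeval z Q = 0) : z.im = 0 := by
  by_contra hz
  obtain ⟨A, t, h1, h2, h3, h4⟩ := logder z hz s hs
  have hz0 : z ≠ 0 := by rintro rfl; simp at hz
  have hG : aeval z (s.map (fun a => (X - C a : ℝ[X]))).prod ≠ 0 := by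
    rw [map_multiset_prod, Multiset.map_map]
    apply Multiset.prod_ne_zero
    intro h
    obtain ⟨a, -, ha⟩ := Multiset.mem_map.1 h
    apply hz
    have := congrArg Complex.im ha
    simpa using this
  set G := (s.map (fun a => (X - C a : ℝ[X]))).prod with hGdef
  have hPz : aeval z P = c * z ^ m * aeval z G := by
    rw [hP]; simp
  have hPz0 : aeval z P ≠ 0 := by
    rw [hPz]
    exact mul_ne_zero (mul_ne_zero (by exact_mod_cast hc) (pow_ne_zero _ hz0)) hG
  have hdP : z * aeval z (derivative P) * (z - 1) = aeval z P * (m * (z - 1) + z * A) := by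
    rw [hPz, hP]
    simp only [derivative_mul, derivative_C, derivative_X_pow, map_mul, map_add, aeval_C, aeval_X,
      map_pow, Complex.coe_algebraMap, zero_mul, zero_add, map_natCast]
    have hzm : (m : ℂ) * (z * z ^ (m - 1)) = m * z ^ m := by
      rcases Nat.eq_zero_or_pos m with rfl | hmp
      · simp
      · rw [← pow_succ', Nat.sub_add_cancel hmp]
    linear_combination (c : ℂ) * z * z ^ m * h1 + (c : ℂ) * aeval z G * (z - 1) * hzm
  have hQ' := congrArg (aeval z) hQ
  simp only [map_mul, map_add, map_sub, map_one, map_natCast, aeval_X, hQz, mul_zero] at hQ'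
  have key : ((r * (m + 1) : ℝ) - n : ℝ) * ((z - 1) / z) + r * A = r * (n + 1) := by
    have : aeval z P * (((r * (m + 1) : ℝ) - n : ℝ) * (z - 1) + z * (r * A) - z * (r * (n + 1))) = 0 := by
      push_cast
      linear_combination hQ' - r * hdP
    have h5 := (mul_eq_zero.1 this).resolve_left hPz0
    field_simp
    linear_combination h5
  set d : ℝ := (r * (m + 1) : ℝ) - n with hd
  have hd0 : 0 ≤ d := by
    rw [hd, sub_nonneg]
    exact_mod_cast hm
  have hrr : (0 : ℝ) < r := by exact_mod_cast hr
  have hns : 0 < Complex.normSq z := Complex.normSq_pos.2 hz0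
  have him := congrArg Complex.im key
  have e1 : ((z - 1) / z).im = z.im * (1 / Complex.normSq z) := by
    rw [Complex.div_im]
    simp
    ring
  have e2 : ((r : ℂ) * (n + 1)).im = 0 := by simp
  have e3 : ((r : ℂ) * A).im = r * A.im := by simp
  rw [e2, Complex.add_im, Complex.im_ofReal_mul, e1, e3, h2] at him
  have hsum : d * (1 / Complex.normSq z) + r * t = 0 := by
    apply mul_left_cancel₀ hz
    linear_combination him
  have p1 : 0 ≤ d * (1 / Complex.normSq z) := by positivity
  have p2 : 0 ≤ r * t := by positivity
  have q1 : d * (1 / Complex.normSq z) = 0 := by linarith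
  have q2 : (r : ℝ) * t = 0 := by linarith
  have d0 : d = 0 := (mul_eq_zero.1 q1).resolve_right (by positivity)
  have t0 : t = 0 := (mul_eq_zero.1 q2).resolve_left hrr.ne'
  rw [d0, h4 t0] at key
  simp only [Complex.ofReal_zero, zero_mul, mul_zero, add_zero] at key
  have : (r : ℂ) * (n + 1) ≠ 0 := by
    apply mul_ne_zero
    · exact_mod_cast hr.ne'
    · exact_mod_cast n.succ_ne_zero
  exact this key.symm

lemma E_pos (n r : ℕ) (hr : 0 < r) (x : ℝ) (hx : 0 < x) : 0 < (Epoly n r).eval x := by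
  have : Nonempty (Fin r) := ⟨⟨0, hr⟩⟩
  unfold Epoly
  rw [eval_finsetSum]
  apply Finset.sum_pos
  · intro w _
    rw [eval_pow, eval_X]
    positivity
  · exact Finset.univ_nonempty

lemma factor_of (p : ℝ[X]) (m : ℕ) (hp : p ≠ 0) (hm : X ^ m ∣ p)
    (hreal : ∀ z : ℂ, aeval z p = 0 → z.im = 0) (hpos : ∀ x : ℝ, 0 < x → 0 < p.eval x) :
    ∃ (c : ℝ) (s : Multiset ℝ), c ≠ 0 ∧ (∀ a ∈ s, a ≤ 0) ∧
      p = C c * X ^ m * (s.map (fun a => (X - C a : ℝ[X]))).prod := by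
  have hsp : p.Splits := by
    apply Splits.of_splits_map (algebraMap ℝ ℂ) (IsAlgClosed.splits _)
    intro a ha
    have h := (mem_roots'.1 ha).2
    rw [IsRoot.def, eval_map_algebraMap] at h
    exact ⟨a.re, Complex.ext (by simp) (by simp [hreal a h])⟩
  obtain ⟨G, hG⟩ := hm
  have hG0 : G ≠ 0 := by rintro rfl; simp at hG; exact hp hG
  have hGs : G.Splits := hsp.of_dvd hp ⟨X ^ m, by rw [hG, mul_comm]⟩
  refine ⟨G.leadingCoeff, G.roots, leadingCoeff_ne_zero.2 hG0, ?_, ?_⟩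
  · intro a ha
    by_contra hlt
    have h1 := hpos a (not_le.1 hlt)
    rw [hG, eval_mul, (mem_roots'.1 ha).2, mul_zero] at h1
    exact lt_irrefl _ h1
  · have h := hGs.eq_prod_roots
    calc p = X ^ m * G := hG
      _ = X ^ m * (C G.leadingCoeff * (G.roots.map (fun a => (X - C a : ℝ[X]))).prod) := by rw [← h]
      _ = _ := by ring

lemma main (r : ℕ) (hr : 0 < r) (n : ℕ) :
    (∀ z : ℂ, aeval z (Epoly (n + 1) r) = 0 → z.im = 0) ∧
      ∃ m, n + 1 ≤ r * (m + 1) ∧ X ^ m ∣ Epoly (n + 1) r := by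
  induction n with
  | zero =>
    have h : Epoly (0 + 1) r = (r : ℝ[X]) := by
      rw [E_eq]; simp [Fp_zero]
    refine ⟨?_, 0, by omega, by simp⟩
    intro z hz
    rw [h, map_natCast] at hz
    exact absurd hz (by exact_mod_cast hr.ne')
  | succ n ih =>
    obtain ⟨hreal, m, hm, hdvd⟩ := ih
    have hpos := E_pos (n + 1) r hr
    have hp : Epoly (n + 1) r ≠ 0 := by
      intro h
      have := hpos 1 one_pos
      rw [h] at this
      simp at this
    obtain ⟨c, s, hc, hs, hfac⟩ := factor_of _ m hp hdvd hreal hpos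
    have hrec := E_rec r (n + 1) hr n.succ_pos
    refine ⟨step_ne (n + 1) r m hr hm c hc s hs _ _ hfac hrec, ?_⟩
    obtain ⟨G, hG⟩ := hdvd
    have hxd : X * derivative (Epoly (n + 1) r) = X ^ m * ((m : ℝ[X]) * G + X * derivative G) := by
      rw [hG, derivative_mul, derivative_X_pow]
      have hzm : (m : ℝ[X]) * (X * X ^ (m - 1)) = (m : ℝ[X]) * X ^ m := by
        rcases Nat.eq_zero_or_pos m with rfl | hmp
        · simp
        · rw [← pow_succ', Nat.sub_add_cancel hmp]
      rw [map_natCast]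
      linear_combination G * hzm
    have hunit : IsUnit (((n + 1 : ℕ) : ℝ[X]) + 1) := by
      have : (((n + 1 : ℕ) : ℝ[X]) + 1) = C ((n : ℝ) + 1 + 1) := by simp
      rw [this, isUnit_C]
      exact (by positivity : (n : ℝ) + 1 + 1 ≠ 0).isUnit
    rcases Nat.lt_or_ge (n + 1) (r * (m + 1)) with hlt | hge
    · refine ⟨m, hlt, ?_⟩
      rw [← hunit.dvd_mul_left, hrec]
      refine dvd_add (Dvd.dvd.mul_left ⟨G, hG⟩ _) ?_
      refine ⟨(r : ℝ[X]) * (1 - X) * ((m : ℝ[X]) * G + X * derivative G), ?_⟩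
      linear_combination (r : ℝ[X]) * (1 - X) * hxd
    · have heq : n + 1 = r * (m + 1) := le_antisymm hm hge
      refine ⟨m + 1, by rw [heq, mul_add r (m + 1) 1]; omega, ?_⟩
      rw [← hunit.dvd_mul_left, hrec]
      have hcast : ((n + 1 : ℕ) : ℝ[X]) = (r : ℝ[X]) * ((m : ℝ[X]) + 1) := by
        rw [heq]; push_cast; ring
      refine ⟨((r : ℝ[X]) * ((n + 1 : ℕ) : ℝ[X]) + ((n + 1 : ℕ) : ℝ[X])) * G
        - (r : ℝ[X]) * (m : ℝ[X]) * G + (r : ℝ[X]) * (1 - X) * derivative G, ?_⟩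
      linear_combination (r : ℝ[X]) * (1 - X) * hxd - X ^ m * G * hcast
        + ((r : ℝ[X]) - ((n + 1 : ℕ) : ℝ[X]) + ((r : ℝ[X]) * ((n + 1 : ℕ) : ℝ[X])
          + ((n + 1 : ℕ) : ℝ[X])) * X) * hG

end EProof

/-- For all positive integers `n` and `r`, the polynomial
`E_{n,r}(x) = Σ_{w ∈ [r]^n} x^{des(w)}` is real-rooted. -/
theorem stmt15 (n r : ℕ) (hn : 0 < n) (hr : 0 < r) : RealRooted (Epoly n r) := by
  obtain ⟨k, rfl⟩ : ∃ k, n = k + 1 := ⟨n - 1, by omega⟩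
  exact Or.inr (EProof.main r hr k).1
end
end

section
/- For every n ≥ 2, the polynomial h_n(x) = Σ_{w ∈ D_n} x^{des(w)} is real-rooted. -/
open Polynomial

open scoped Classical

noncomputable section

/-- Interlacing relation at a point `z` of the upper half plane. -/
def RRel (z x y : ℂ) : Prop :=
  0 ≤ (y * (starRingEnd ℂ) x).im ∧ 0 ≤ (z * x * (starRingEnd ℂ) y).im

lemma RRel_sum (z : ℂ) (S T : Finset ℤ) (f : ℤ → ℂ)
    (h : ∀ i ∈ S, ∀ j ∈ T, RRel z (f i) (f j)) :
    RRel z (∑ i ∈ S, f i) (∑ j ∈ T, f j) := by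
  constructor
  · rw [map_sum, Finset.sum_mul_sum, Complex.im_sum]
    refine Finset.sum_nonneg fun j hj => ?_
    rw [Complex.im_sum]
    exact Finset.sum_nonneg fun i hi => (h i hi j hj).1
  · rw [map_sum, Finset.mul_sum S, Finset.sum_mul_sum, Complex.im_sum]
    refine Finset.sum_nonneg fun i hi => ?_
    rw [Complex.im_sum]
    exact Finset.sum_nonneg fun j hj => (h i hi j hj).2

lemma RRel_step (z A B C : ℂ) (hz : 0 < z.im) (hAB : RRel z A B) (hAC : RRel z A C)
    (hBC : RRel z B C) : RRel z (z * A + (B + C)) (z * (A + B) + C) := by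
  obtain ⟨h1, h2⟩ := hAB
  obtain ⟨h3, h4⟩ := hAC
  obtain ⟨h5, h6⟩ := hBC
  have hn := Complex.normSq_nonneg z
  constructor
  · have key : ((z * (A + B) + C) * (starRingEnd ℂ) (z * A + (B + C))).im
        = (z * A * (starRingEnd ℂ) B).im + Complex.normSq z * (B * (starRingEnd ℂ) A).im
          + z.im * Complex.normSq B + (z * B * (starRingEnd ℂ) C).im
          + (C * (starRingEnd ℂ) B).im := by
      simp [Complex.normSq_apply]
      ring
    rw [key]
    have := Complex.normSq_nonneg B
    positivity
  · have key : (z * (z * A + (B + C)) * (starRingEnd ℂ) (z * (A + B) + C)).im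
        = Complex.normSq z * (z * A * (starRingEnd ℂ) B).im
          + Complex.normSq z * (B * (starRingEnd ℂ) A).im
          + (z * B * (starRingEnd ℂ) C).im
          + Complex.normSq z * (C * (starRingEnd ℂ) B).im
          + z.im * Complex.normSq (z * A + C) := by
      simp [Complex.normSq_apply]
      ring
    rw [key]
    have := Complex.normSq_nonneg (z * A + C)
    positivity

/-- If `x ≠ 0`, `RRel z x y`, and the cross term is real, then the product is nonnegative. -/
lemma RRel_re (z x y : ℂ) (hz : 0 < z.im) (h : RRel z x y)
    (h0 : (y * (starRingEnd ℂ) x).im = 0) : 0 ≤ (y * (starRingEnd ℂ) x).re := by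
  have h2 := h.2
  have key : (z * x * (starRingEnd ℂ) y).im
      = z.im * (y * (starRingEnd ℂ) x).re - z.re * (y * (starRingEnd ℂ) x).im := by
    simp; ring
  rw [key, h0] at h2
  by_contra! hlt
  nlinarith [mul_neg_of_pos_of_neg hz hlt]

lemma sum_ne_zero_of_RRel {ι : Type*} (z : ℂ) (hz : 0 < z.im) (S : Finset ι) (hS : S.Nonempty)
    (k : ι → ℤ) (g : ι → ℂ) (hg : ∀ i ∈ S, g i ≠ 0)
    (h : ∀ i ∈ S, ∀ j ∈ S, k i ≤ k j → RRel z (g i) (g j)) : ∑ i ∈ S, g i ≠ 0 := by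
  intro hsum
  obtain ⟨i, hi, hmin⟩ := S.exists_min_image k hS
  have e : ∑ j ∈ S, g j * (starRingEnd ℂ) (g i) = 0 := by
    rw [← Finset.sum_mul, hsum, zero_mul]
  have eim : ∑ j ∈ S, (g j * (starRingEnd ℂ) (g i)).im = 0 := by
    rw [← Complex.im_sum, e]; rfl
  have ere : ∑ j ∈ S, (g j * (starRingEnd ℂ) (g i)).re = 0 := by
    rw [← Complex.re_sum, e]; rfl
  have him := (Finset.sum_eq_zero_iff_of_nonneg
    (fun j hj => (h i hi j hj (hmin j hj)).1)).1 eim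
  have hre := (Finset.sum_eq_zero_iff_of_nonneg
    (fun j hj => RRel_re z _ _ hz (h i hi j hj (hmin j hj)) (him j hj))).1 ere i hi
  rw [Complex.mul_conj] at hre
  exact hg i hi (Complex.normSq_eq_zero.1 (by simpa using hre))

/-- The basic transfer operator. -/
def Gop (z : ℂ) (r : ℤ) (f : ℤ → ℂ) (a : ℤ) : ℂ :=
  ∑ i ∈ Finset.Icc 1 r, (if i ≤ a then z else 1) * f i

lemma Gop_eq (z : ℂ) (r : ℤ) (f : ℤ → ℂ) (a : ℤ) :
    Gop z r f a = z * (∑ i ∈ (Finset.Icc 1 r).filter (fun i => i ≤ a), f i)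
      + ∑ i ∈ (Finset.Icc 1 r).filter (fun i => ¬ i ≤ a), f i := by
  unfold Gop
  rw [← Finset.sum_filter_add_sum_filter_not (Finset.Icc 1 r) (fun i => i ≤ a), Finset.mul_sum]
  congr 1
  · refine Finset.sum_congr rfl fun i hi => ?_
    rw [if_pos (Finset.mem_filter.1 hi).2]
  · refine Finset.sum_congr rfl fun i hi => ?_
    rw [if_neg (Finset.mem_filter.1 hi).2, one_mul]

/-- The invariant. -/
def Good (z : ℂ) (r : ℤ) (f : ℤ → ℂ) : Prop :=
  (∀ i ∈ Finset.Icc 1 r, f i ≠ 0) ∧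
  ∀ i ∈ Finset.Icc 1 r, ∀ j ∈ Finset.Icc 1 r, i ≤ j → RRel z (f i) (f j)

lemma Gop_rel (z : ℂ) (hz : 0 < z.im) (r : ℤ) (f : ℤ → ℂ) (hf : Good z r f) (a b : ℤ)
    (hab : a ≤ b) : RRel z (Gop z r f a) (Gop z r f b) := by
  set SA := (Finset.Icc 1 r).filter (fun i => i ≤ a)
  set SB := (Finset.Icc 1 r).filter (fun i => a < i ∧ i ≤ b)
  set SC := (Finset.Icc 1 r).filter (fun i => ¬ i ≤ b)
  have e1 : (Finset.Icc 1 r).filter (fun i => ¬ i ≤ a) = SB ∪ SC := by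
    ext i; simp [SB, SC]; omega
  have e2 : (Finset.Icc 1 r).filter (fun i => i ≤ b) = SA ∪ SB := by
    ext i; simp [SA, SB]; omega
  have d1 : Disjoint SB SC := by
    rw [Finset.disjoint_left]; intro i; simp [SB, SC]; omega
  have d2 : Disjoint SA SB := by
    rw [Finset.disjoint_left]; intro i; simp [SA, SB]; omega
  rw [Gop_eq z r f a, Gop_eq z r f b, e1, e2, Finset.sum_union d1, Finset.sum_union d2]
  refine RRel_step z _ _ _ hz ?_ ?_ ?_ <;> refine RRel_sum z _ _ f fun i hi j hj => ?_ <;>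
  · have hi' := Finset.mem_filter.1 hi
    have hj' := Finset.mem_filter.1 hj
    exact hf.2 i hi'.1 j hj'.1 (by omega)

lemma Gop_ne (z : ℂ) (hz : 0 < z.im) (r : ℤ) (hr : 1 ≤ r) (f : ℤ → ℂ) (hf : Good z r f) (a : ℤ) :
    Gop z r f a ≠ 0 := by
  have hsub : ∀ S : Finset ℤ, S ⊆ Finset.Icc 1 r → S.Nonempty → ∑ i ∈ S, f i ≠ 0 := by
    intro S hS hp
    refine sum_ne_zero_of_RRel z hz _ hp id f (fun i hi => hf.1 i (hS hi)) ?_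
    intro i hi j hj hij
    exact hf.2 i (hS hi) j (hS hj) hij
  have hrel : RRel z (∑ i ∈ (Finset.Icc 1 r).filter (fun i => i ≤ a), f i)
      (∑ i ∈ (Finset.Icc 1 r).filter (fun i => ¬ i ≤ a), f i) := by
    refine RRel_sum z _ _ f fun i hi j hj => ?_
    have hi' := Finset.mem_filter.1 hi
    have hj' := Finset.mem_filter.1 hj
    exact hf.2 i hi'.1 j hj'.1 (by omega)
  rw [Gop_eq]
  intro h0
  have hA : ∑ i ∈ (Finset.Icc 1 r).filter (fun i => i ≤ a), f i = 0 := by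
    rw [← Complex.normSq_eq_zero]
    have hB := eq_neg_of_add_eq_zero_right h0
    have h1 := hrel.1
    rw [hB, neg_mul, mul_assoc, Complex.mul_conj, Complex.neg_im, Complex.im_mul_ofReal] at h1
    have := Complex.normSq_nonneg (∑ i ∈ (Finset.Icc 1 r).filter (fun i => i ≤ a), f i)
    nlinarith
  rw [hA, mul_zero, zero_add] at h0
  by_cases h1 : 1 ≤ a
  · exact hsub _ (Finset.filter_subset _ _) ⟨1, Finset.mem_filter.2 ⟨Finset.mem_Icc.2 ⟨le_rfl, hr⟩, h1⟩⟩ hA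
  · exact hsub _ (Finset.filter_subset _ _) ⟨1, Finset.mem_filter.2 ⟨Finset.mem_Icc.2 ⟨le_rfl, hr⟩, h1⟩⟩ h0

/-- The descent condition. -/
def isD (c i : ℤ) : Prop := i < |c| ∨ (c = i ∧ 0 < i)

/-- Generating function of tails of length `m` following the letter `c`. -/
def Fgen (z : ℂ) (r : ℤ) : ℕ → ℤ → ℂ
  | 0, _ => 1
  | m + 1, c => ∑ i ∈ Finset.Icc 1 r, (if isD c i then z else 1) * Fgen z r m i

/-- First-letter index. -/
def tauD (c : ℤ) : ℤ := if 0 < c then c else -c - 1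

lemma Fgen_succ (z : ℂ) (r : ℤ) (m : ℕ) (c : ℤ) :
    Fgen z r (m + 1) c = Gop z r (Fgen z r m) (tauD c) := by
  rw [Fgen, Gop]
  refine Finset.sum_congr rfl fun i hi => ?_
  have hi' := Finset.mem_Icc.1 hi
  have : isD c i ↔ i ≤ tauD c := by
    unfold isD tauD
    split_ifs with h
    · rw [abs_of_pos h]; omega
    · rw [abs_of_nonpos (by omega)]; omega
  simp only [this]

lemma Fgen_good (z : ℂ) (hz : 0 < z.im) (r : ℤ) (hr : 1 ≤ r) (m : ℕ) : Good z r (Fgen z r m) := by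
  induction m with
  | zero =>
    refine ⟨fun i _ => by simp [Fgen], fun i _ j _ _ => ?_⟩
    simp [RRel, Fgen, hz.le]
  | succ m ih =>
    refine ⟨fun i _ => ?_, fun i hi j hj hij => ?_⟩
    · rw [Fgen_succ]; exact Gop_ne z hz r hr _ ih _
    · rw [Fgen_succ, Fgen_succ]
      refine Gop_rel z hz r _ ih _ _ ?_
      have := Finset.mem_Icc.1 hi
      have := Finset.mem_Icc.1 hj
      rw [tauD, tauD, if_pos (by omega), if_pos (by omega)]
      exact hij

/-- Weight of a word. -/
def wtD (z : ℂ) {m : ℕ} (w : Fin (m + 1) → ℤ) : ℂ :=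
  ∏ i : Fin m, if isD (w i.castSucc) (w i.succ) then z else 1

lemma wtD_cons (z : ℂ) {m : ℕ} (c : ℤ) (w : Fin (m + 1) → ℤ) :
    wtD z (Fin.cons c w : Fin (m + 2) → ℤ) = (if isD c (w 0) then z else 1) * wtD z w := by
  unfold wtD
  rw [Fin.prod_univ_succ]
  simp

lemma sum_cons (m : ℕ) (S : Fin (m + 1) → Finset ℤ) (φ : (Fin (m + 1) → ℤ) → ℂ) :
    ∑ w ∈ Fintype.piFinset S, φ w
      = ∑ a ∈ S 0, ∑ t ∈ Fintype.piFinset (fun i : Fin m => S i.succ), φ (Fin.cons a t) := by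
  rw [← Finset.sum_product']
  refine Finset.sum_bij' (fun w _ => (w 0, Fin.tail w)) (fun p _ => Fin.cons p.1 p.2) ?_ ?_ ?_ ?_ ?_
  · intro w hw
    rw [Fintype.mem_piFinset] at hw
    simp only [Finset.mem_product, Fintype.mem_piFinset]
    exact ⟨hw 0, fun i => hw i.succ⟩
  · intro p hp
    simp only [Finset.mem_product, Fintype.mem_piFinset] at hp
    rw [Fintype.mem_piFinset]
    intro i
    refine Fin.cases ?_ (fun j => ?_) i
    · simpa using hp.1
    · simpa using hp.2 j
  · intro w _; simp
  · intro p _; simp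
  · intro w _; simp

lemma sum_wtD (z : ℂ) (r : ℤ) (m : ℕ) (c : ℤ) :
    ∑ t ∈ Fintype.piFinset (fun _ : Fin m => Finset.Icc 1 r),
      wtD z (Fin.cons c t : Fin (m + 1) → ℤ) = Fgen z r m c := by
  induction m generalizing c with
  | zero => simp [wtD, Fgen]
  | succ m ih =>
    rw [sum_cons, Fgen]
    refine Finset.sum_congr rfl fun a _ => ?_
    rw [← ih a, Finset.mul_sum]
    refine Finset.sum_congr rfl fun t _ => ?_
    rw [wtD_cons]; simp

lemma pow_descSetD (z : ℂ) {m : ℕ} (w : Fin (m + 1) → ℤ) :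
    z ^ (descSetD w).card = wtD z w := by
  unfold descSetD wtD
  rw [Finset.card_image_of_injective _ (fun a b h => by
    simp only [add_left_inj] at h; exact Fin.ext h)]
  rw [Finset.prod_ite, Finset.prod_const_one, mul_one, Finset.prod_const]
  refine congrArg (fun k : ℕ => z ^ k) (congrArg Finset.card ?_)
  refine Finset.ext fun (i : Fin m) => ?_
  refine Finset.mem_filter.trans (Iff.trans ?_ Finset.mem_filter.symm)
  exact Iff.rfl

/-- Signed first letters. -/
def firstL (n : ℕ) : Finset ℤ :=
  (Finset.Icc (-(n : ℤ)) n).filter (fun a => 1 ≤ |a| ∧ |a| ≤ (n : ℤ) - 1)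

lemma Dword_eq (n m : ℕ) : Dword n (m + 1)
    = Fintype.piFinset (Fin.cons (firstL n) (fun _ : Fin m => Finset.Icc 1 ((n : ℤ) - 1))) := by
  ext w
  simp only [Dword, Finset.mem_filter, Fintype.mem_piFinset, Finset.mem_Icc]
  constructor
  · rintro ⟨h1, h2⟩ i
    have h1i := h1 i
    have h2i := h2 i
    revert h1i h2i
    refine Fin.cases ?_ (fun j => ?_) i
    · intro h1i h2i
      simp only [Fin.cons_zero, firstL, Finset.mem_filter, Finset.mem_Icc]
      exact ⟨h1i, h2i.1 rfl⟩
    · intro h1i h2i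
      simp only [Fin.cons_succ, Finset.mem_Icc]
      exact h2i.2 (by simp)
  · intro h
    rw [← forall_and]
    intro i
    have hi := h i
    revert hi
    refine Fin.cases ?_ (fun j => ?_) i
    · simp only [Fin.cons_zero, firstL, Finset.mem_filter, Finset.mem_Icc]
      intro hi
      exact ⟨hi.1, fun _ => hi.2, fun h => absurd rfl h⟩
    · simp only [Fin.cons_succ, Finset.mem_Icc]
      intro hi
      exact ⟨by omega, fun h => by simp at h, fun _ => hi⟩

lemma sum_Dword (z : ℂ) (n m : ℕ) : ∑ w ∈ Dword n (m + 1), z ^ (descSetD w).card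
    = ∑ a ∈ firstL n, Fgen z ((n : ℤ) - 1) m a := by
  rw [Dword_eq, sum_cons]
  simp only [Fin.cons_zero, Fin.cons_succ, pow_descSetD, sum_wtD]

lemma sum_Dword_ne (z : ℂ) (hz : 0 < z.im) (m : ℕ) :
    ∑ w ∈ Dword (m + 2) (m + 2), z ^ (descSetD w).card ≠ 0 := by
  rw [sum_Dword]
  have hr : (1 : ℤ) ≤ ((m + 2 : ℕ) : ℤ) - 1 := by push_cast; omega
  refine sum_ne_zero_of_RRel z hz _ ⟨1, ?_⟩ tauD _ (fun i _ => ?_) (fun i _ j _ hij => ?_)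
  · simp [firstL]; omega
  · rw [Fgen_succ]; exact Gop_ne z hz _ hr _ (Fgen_good z hz _ hr m) _
  · rw [Fgen_succ, Fgen_succ]; exact Gop_rel z hz _ _ (Fgen_good z hz _ hr m) _ _ hij

/-- For every `n ≥ 2`, the polynomial `h_n(x) = Σ_{w ∈ D_n} x^{des(w)}`
is real-rooted, where `D_n = D_{n,n}`. -/
theorem stmt16 (n : ℕ) (hn : 2 ≤ n) :
    RealRooted (∑ w ∈ Dword n n, X ^ (descSetD w).card) := by
  right
  intro z hz
  obtain ⟨m, rfl⟩ := Nat.exists_eq_add_of_le' hn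
  simp only [map_sum, map_pow, aeval_X] at hz
  rcases lt_trichotomy z.im 0 with h | h | h
  · exfalso
    refine sum_Dword_ne ((starRingEnd ℂ) z) (by simpa using h) m ?_
    have := congrArg (starRingEnd ℂ) hz
    simpa only [map_sum, map_pow, map_zero] using this
  · exact h
  · exact absurd hz (sum_Dword_ne z h m)
end
end

section
/- For all positive integers n and r, x^n E_{n,r}(1/x) = S_r( x·(1 + x + x^2 + ... + x^{r-1})^{n+1} ), where x^n E_{n,r}(1/x) denotes the polynomial Σ_{k=0}^n e_{n-k} x^k with e_j the coefficient of x^j in E_{n,r}(x) (extended by e_j = 0 for j > deg E_{n,r}), and S_r is the operator sending a polynomial Σ_m h_m x^m to Σ_m h_{rm} x^m. -/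
open Polynomial

open scoped Classical

noncomputable section

/-- The `r`-th Veronese operator `S_r`, sending `Σ_m h_m x^m` to `Σ_m h_{rm} x^m`. -/
def veronese (r : ℕ) (p : Polynomial ℝ) : Polynomial ℝ :=
  ∑ m ∈ Finset.range (p.natDegree + 1), C (p.coeff (r * m)) * X ^ m

/-- Number of strict ascents of a nonempty word. -/
def ascW {m r : ℕ} (w : Fin (m + 1) → Fin r) : ℕ :=
  ∑ i : Fin m, if w i.castSucc < w i.succ then 1 else 0

lemma descSetW_card_add {m r : ℕ} (w : Fin (m + 1) → Fin r) :
    (descSetW w).card + ascW w = m := by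
  unfold descSetW ascW
  rw [Finset.card_image_of_injective _ (fun a b h => Fin.ext (by simpa using h)),
    ← Finset.card_filter]
  have h := Finset.card_filter_add_card_filter_not (s := (Finset.univ : Finset (Fin m)))
    (fun i : Fin m => w i.succ ≤ w i.castSucc)
  simp only [not_le, Finset.card_univ, Fintype.card_fin] at h
  exact h

lemma step_sum {r : ℕ} (i : Fin r) :
    (∑ j : Fin r, (X : Polynomial ℝ) ^ ((if j < i then r else 0) + (j : ℕ))) =
      X ^ (i : ℕ) * ∑ c ∈ Finset.range r, (X : Polynomial ℝ) ^ c := by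
  obtain ⟨i, hi⟩ := i
  simp only [Fin.lt_def]
  rw [Fin.sum_univ_eq_sum_range
    (fun j => (X : Polynomial ℝ) ^ ((if j < i then r else 0) + j)) r]
  obtain ⟨s, rfl⟩ := Nat.exists_eq_add_of_lt hi
  have e : i + s + 1 = i + (s + 1) := by omega
  have e2 : i + s + 1 = (s + 1) + i := by omega
  conv_rhs => rw [e2, Finset.sum_range_add, mul_add, Finset.mul_sum, Finset.mul_sum, add_comm]
  rw [show Finset.range (i + s + 1) = Finset.range (i + (s + 1)) by rw [e],
    Finset.sum_range_add]
  congr 1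
  · refine Finset.sum_congr rfl fun j hj => ?_
    rw [if_pos (Finset.mem_range.mp hj), ← pow_add]
    congr 1
    omega
  · refine Finset.sum_congr rfl fun j hj => ?_
    rw [if_neg (by omega), ← pow_add]
    congr 1
    omega

lemma gen_sum (r m : ℕ) :
    (∑ w : Fin (m + 1) → Fin r, (X : Polynomial ℝ) ^ (r * ascW w + (w 0 : ℕ))) =
      (∑ c ∈ Finset.range r, (X : Polynomial ℝ) ^ c) ^ (m + 1) := by
  induction m with
  | zero =>
    rw [Fintype.sum_equiv (Equiv.funUnique (Fin 1) (Fin r)) _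
      (fun j : Fin r => (X : Polynomial ℝ) ^ (j : ℕ))
      (fun w => by simp [ascW]), Fin.sum_univ_eq_sum_range (fun j => (X : Polynomial ℝ) ^ j) r]
    simp
  | succ m ih =>
    rw [pow_succ, ← ih, Finset.sum_mul,
      ← Fintype.sum_equiv (Fin.consEquiv (fun _ : Fin (m + 2) => Fin r))
        (fun p => (X : Polynomial ℝ) ^
          (r * ascW (Fin.cons p.1 p.2 : Fin (m + 2) → Fin r) + (p.1 : ℕ))) _
        (fun p => by simp [Fin.consEquiv]),
      Fintype.sum_prod_type_right]
    refine Finset.sum_congr rfl fun w _ => ?_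
    rw [pow_add, mul_assoc, ← step_sum, Finset.mul_sum]
    refine Finset.sum_congr rfl fun j _ => ?_
    rw [← pow_add]
    congr 1
    have : ascW (Fin.cons j w : Fin (m + 2) → Fin r) = (if j < w 0 then 1 else 0) + ascW w := by
      unfold ascW
      rw [Fin.sum_univ_succ]
      simp [← Fin.succ_castSucc]
    rw [this]
    split_ifs <;> ring

lemma coeff_key (r m k : ℕ) :
    (X * (∑ i ∈ Finset.range r, (X : Polynomial ℝ) ^ i) ^ (m + 2)).coeff (r * k) =
      ∑ w : Fin (m + 1) → Fin r, if k = ascW w + 1 then (1 : ℝ) else 0 := by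
  rw [pow_succ, ← gen_sum, Finset.sum_mul, Finset.mul_sum, finset_sum_coeff]
  refine Finset.sum_congr rfl fun w _ => ?_
  rw [Finset.mul_sum, Finset.mul_sum, finset_sum_coeff]
  have hw := (w 0).isLt
  have : ∀ c ∈ Finset.range r, (X * ((X : Polynomial ℝ) ^ (r * ascW w + (w 0 : ℕ)) * X ^ c)).coeff
      (r * k) = if c = r - 1 - (w 0 : ℕ) then (if k = ascW w + 1 then (1 : ℝ) else 0) else 0 := by
    intro c hc
    rw [Finset.mem_range] at hc
    rw [← pow_add, ← pow_succ', coeff_X_pow, ← ite_and]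
    congr 1
    apply propext
    constructor
    · intro h
      have hk : k = ascW w + 1 := by
        have h1 : r * ascW w < r * k := by omega
        have h2 : r * k < r * (ascW w + 2) := by rw [mul_add]; omega
        have := Nat.lt_of_mul_lt_mul_left h1
        have := Nat.lt_of_mul_lt_mul_left h2
        omega
      refine ⟨?_, hk⟩
      rw [hk, mul_add] at h
      omega
    · rintro ⟨h1, h2⟩
      rw [h2, mul_add]
      omega
  rw [Finset.sum_congr rfl this, Finset.sum_ite_eq', if_pos (by simp; omega)]

lemma veronese_coeff (r : ℕ) (hr : 0 < r) (p : Polynomial ℝ) (k : ℕ) :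
    (veronese r p).coeff k = p.coeff (r * k) := by
  unfold veronese
  simp only [finset_sum_coeff, coeff_C_mul, coeff_X_pow, mul_ite, mul_one, mul_zero,
    Finset.sum_ite_eq, Finset.mem_range]
  split_ifs with h
  · rfl
  · symm
    apply coeff_eq_zero_of_natDegree_lt
    have := Nat.le_mul_of_pos_left k hr
    omega

/-- For all positive integers `n` and `r`,
`x^n E_{n,r}(1/x) = S_r(x·(1 + x + ⋯ + x^{r-1})^{n+1})`, where `x^n E_{n,r}(1/x)`
denotes the reversal `Σ_{k=0}^n e_{n-k} x^k` of `E_{n,r}(x) = Σ_j e_j x^j`. -/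
theorem stmt19 (n r : ℕ) (hn : 0 < n) (hr : 0 < r) :
    (∑ k ∈ Finset.range (n + 1), C ((Epoly n r).coeff (n - k)) * X ^ k) =
      veronese r (X * (∑ i ∈ Finset.range r, (X : Polynomial ℝ) ^ i) ^ (n + 1)) := by
  obtain ⟨m, rfl⟩ : ∃ m, n = m + 1 := ⟨n - 1, by omega⟩
  ext k
  rw [veronese_coeff r hr, coeff_key]
  simp only [finset_sum_coeff, coeff_C_mul, coeff_X_pow, mul_ite, mul_one, mul_zero,
    Finset.sum_ite_eq, Finset.mem_range, Epoly]
  split_ifs with h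
  · refine Finset.sum_congr rfl fun w _ => ?_
    have := descSetW_card_add w
    congr 1
    apply propext
    omega
  · symm
    refine Finset.sum_eq_zero fun w _ => if_neg ?_
    have := descSetW_card_add w
    omega
end
end
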